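/- arXiv:2111.12468 — 5 statements merged into one kernel-verified Lean document; each statement's English description precedes it below -/
import Mathlib

section
/- The horofunction compactification of ((0,∞)ⁿ, d_T) with basepoint u = (1,…,1) is homeomorphic to the closed unit ball of the dual norm of the supremum norm on ℝⁿ, namely to the set {y ∈ ℝⁿ : |y_1| + ⋯ + |y_n| ≤ 1} with its Euclidean topology. -/
open Filter Topology

/-- The internal function `h_y(z) = d(z,y) - d(b,y)` of a point `y`, for the
distance `d` with basepoint `b`. -/
noncomputable def intFn {M : Type*} (d : M → M → ℝ) (b y : M) : M → ℝ :=
  fun z => d z y - d b y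

/-- The horofunction compactification of `(M,d)` with basepoint `b`: the closure of the
set of internal functions in the space of all real functions on `M` with the topology of
pointwise convergence. -/
def horoCpt {M : Type*} (d : M → M → ℝ) (b : M) : Set (M → ℝ) :=
  closure (Set.range (intFn d b))

/-- The detour cost `H(h,h')`. -/
noncomputable def detourCost {M : Type*} (d : M → M → ℝ) (b : M) (h h' : M → ℝ) : EReal :=
  ⨆ W ∈ 𝓝[horoCpt d b] h, ⨅ x ∈ {x : M | intFn d b x ∈ W}, ((d b x + h' x : ℝ) : EReal)

/-- The detour distance `δ(h,h') = H(h,h') + H(h',h)`. -/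
noncomputable def detourDist {M : Type*} (d : M → M → ℝ) (b : M) (h h' : M → ℝ) : EReal :=
  detourCost d b h h' + detourCost d b h' h

/-- The open positive orthant `(0,∞)ⁿ`. -/
def Pos (n : ℕ) : Type := {x : Fin n → ℝ // ∀ i, 0 < x i}

/-- The Thompson distance on the open positive orthant. -/
noncomputable def dT (n : ℕ) (x y : Pos n) : ℝ :=
  ⨆ i, |Real.log (x.1 i) - Real.log (y.1 i)|

/-- The basepoint `u = (1,…,1)` of the positive orthant. -/
def uPos (n : ℕ) : Pos n := ⟨fun _ => 1, fun _ => one_pos⟩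

/-- The larger root of `X² - t X - c`. -/
noncomputable def quadRoot (c t : ℝ) : ℝ := (t + √(t ^ 2 + 4 * c)) / 2

theorem quadRoot_mul_sub {a b : ℝ} (ha : 0 ≤ a) (hb : 0 ≤ b) : quadRoot (a * b) (a - b) = a := by
  have h : (a - b) ^ 2 + 4 * (a * b) = (a + b) ^ 2 := by ring
  rw [quadRoot, h, Real.sqrt_sq (by positivity)]
  ring

theorem abs_le_sqrt_sq_add {c : ℝ} (hc : 0 ≤ c) (t : ℝ) : |t| ≤ √(t ^ 2 + 4 * c) :=
  Real.abs_le_sqrt (by linarith)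

theorem quadRoot_nonneg {c : ℝ} (hc : 0 ≤ c) (t : ℝ) : 0 ≤ quadRoot c t := by
  have := abs_le.1 (abs_le_sqrt_sq_add hc t)
  unfold quadRoot
  linarith

theorem quadRoot_sub_quadRoot_neg (c t : ℝ) : quadRoot c t - quadRoot c (-t) = t := by
  simp only [quadRoot, neg_sq]
  ring

theorem quadRoot_mul_quadRoot_neg {c : ℝ} (hc : 0 ≤ c) (t : ℝ) :
    quadRoot c t * quadRoot c (-t) = c := by
  have h : √(t ^ 2 + 4 * c) ^ 2 = t ^ 2 + 4 * c := Real.sq_sqrt (by positivity)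
  simp only [quadRoot, neg_sq]
  linear_combination h / 4

theorem quadRoot_le_one {c t : ℝ} (hc : 0 ≤ c) (ht : t ≤ 1 - c) : quadRoot c t ≤ 1 := by
  have : √(t ^ 2 + 4 * c) ≤ 2 - t := Real.sqrt_le_iff.2 ⟨by linarith, by nlinarith⟩
  unfold quadRoot
  linarith

theorem quadRoot_one_sub {c : ℝ} (hc : 0 ≤ c) : quadRoot c (1 - c) = 1 := by
  simpa using quadRoot_mul_sub zero_le_one hc

theorem exists_norm_apply_eq {ι E : Type*} [Fintype ι] [Nonempty ι] [SeminormedAddCommGroup E]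
    (f : ι → E) : ∃ i, ‖f i‖ = ‖f‖ := by
  obtain ⟨i, hi⟩ := Finite.exists_max fun i => ‖f i‖
  exact ⟨i, le_antisymm (norm_le_pi_norm f i) ((pi_norm_le_iff_of_nonempty _).2 hi)⟩

/-- The vector whose sup norm is the exponential of the Thompson distance. -/
noncomputable def ratioVec {n : ℕ} (x y : Pos n) : Fin n → ℝ × ℝ :=
  fun i => (x.1 i / y.1 i, y.1 i / x.1 i)

theorem norm_ratioVec_pos {n : ℕ} [Nonempty (Fin n)] (x y : Pos n) : 0 < ‖ratioVec x y‖ := by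
  obtain ⟨i⟩ := ‹Nonempty (Fin n)›
  refine lt_of_lt_of_le ?_ ((norm_fst_le _).trans (norm_le_pi_norm (ratioVec x y) i))
  exact norm_pos_iff.2 (div_pos (x.2 i) (y.2 i)).ne'

theorem dT_eq_log_norm {n : ℕ} [Nonempty (Fin n)] (x y : Pos n) :
    dT n x y = Real.log ‖ratioVec x y‖ := by
  have hpos := norm_ratioVec_pos x y
  apply le_antisymm
  · refine ciSup_le fun i => ?_
    have hi := norm_le_pi_norm (ratioVec x y) i
    have h₁ := Real.log_le_log (div_pos (x.2 i) (y.2 i))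
      ((le_abs_self _).trans ((norm_fst_le _).trans hi))
    have h₂ := Real.log_le_log (div_pos (y.2 i) (x.2 i))
      ((le_abs_self _).trans ((norm_snd_le _).trans hi))
    rw [Real.log_div (x.2 i).ne' (y.2 i).ne'] at h₁
    rw [Real.log_div (y.2 i).ne' (x.2 i).ne'] at h₂
    exact abs_le.2 ⟨by linarith, h₁⟩
  · rw [Real.log_le_iff_le_exp hpos, pi_norm_le_iff_of_nonempty]
    intro i
    have hi : |Real.log (x.1 i) - Real.log (y.1 i)| ≤ dT n x y :=
      le_ciSup (f := fun i => |Real.log (x.1 i) - Real.log (y.1 i)|) (Set.finite_range _).bddAbove i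
    have hxy := div_pos (x.2 i) (y.2 i)
    have hyx := div_pos (y.2 i) (x.2 i)
    refine norm_prod_le_iff.2 ⟨?_, ?_⟩
    · rw [ratioVec, Real.norm_of_nonneg hxy.le, ← Real.log_le_iff_le_exp hxy,
        Real.log_div (x.2 i).ne' (y.2 i).ne']
      exact (le_abs_self _).trans hi
    · rw [ratioVec, Real.norm_of_nonneg hyx.le, ← Real.log_le_iff_le_exp hyx,
        Real.log_div (y.2 i).ne' (x.2 i).ne', ← neg_sub]
      exact (neg_le_abs _).trans hi

/-- The vector `(aᵢ xᵢ, bᵢ / xᵢ)`, where `aᵢ, bᵢ ≥ 0` are determined by `aᵢ - bᵢ = wᵢ` and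
`aᵢ bᵢ = 1 - ‖w‖`. -/
noncomputable def horoVec {n : ℕ} (w : Fin n → ℝ) (x : Pos n) : Fin n → ℝ × ℝ :=
  fun i => (quadRoot (1 - ‖w‖) (w i) * x.1 i, quadRoot (1 - ‖w‖) (-w i) / x.1 i)

/-- The point of the horofunction compactification parametrized by the point `w` of the cube. -/
noncomputable def horoFn {n : ℕ} (w : Fin n → ℝ) (x : Pos n) : ℝ := Real.log ‖horoVec w x‖

section

variable {n : ℕ} {w : Fin n → ℝ}

theorem quadRoot_one_sub_norm_le_one (hw : ‖w‖ ≤ 1) (i : Fin n) :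
    quadRoot (1 - ‖w‖) (w i) ≤ 1 ∧ quadRoot (1 - ‖w‖) (-w i) ≤ 1 := by
  have := abs_le.1 (norm_le_pi_norm w i)
  exact ⟨quadRoot_le_one (by linarith) (by linarith),
    quadRoot_le_one (by linarith) (by linarith)⟩

theorem exists_quadRoot_eq_one [Nonempty (Fin n)] (hw : ‖w‖ ≤ 1) :
    ∃ i, quadRoot (1 - ‖w‖) (w i) = 1 ∨ quadRoot (1 - ‖w‖) (-w i) = 1 := by
  obtain ⟨i, hi⟩ := exists_norm_apply_eq w
  have h := quadRoot_one_sub (sub_nonneg.2 hw)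
  rw [sub_sub_cancel] at h
  refine ⟨i, ?_⟩
  rcases abs_choice (w i) with h' | h' <;> rw [Real.norm_eq_abs, h'] at hi <;> rw [hi] <;> simp [h]

theorem norm_horoVec_pos [Nonempty (Fin n)] (hw : ‖w‖ ≤ 1) (x : Pos n) : 0 < ‖horoVec w x‖ := by
  obtain ⟨i, hi⟩ := exists_quadRoot_eq_one hw
  refine lt_of_lt_of_le (norm_pos_iff.2 fun h => ?_) (norm_le_pi_norm (horoVec w x) i)
  have hx := (x.2 i).ne'
  simp only [horoVec, Prod.mk_eq_zero] at h
  rcases hi with hi | hi <;> simp [hi, hx] at h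

theorem norm_horoVec_uPos [Nonempty (Fin n)] (hw : ‖w‖ ≤ 1) : ‖horoVec w (uPos n)‖ = 1 := by
  have hc := sub_nonneg.2 hw
  apply le_antisymm
  · refine (pi_norm_le_iff_of_nonempty _).2 fun i => norm_prod_le_iff.2 ?_
    simpa [horoVec, uPos, abs_of_nonneg, quadRoot_nonneg hc] using quadRoot_one_sub_norm_le_one hw i
  · obtain ⟨i, hi⟩ := exists_quadRoot_eq_one hw
    refine le_trans ?_ (norm_le_pi_norm (horoVec w (uPos n)) i)
    rcases hi with hi | hi <;> simp [horoVec, uPos, hi]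

theorem continuousOn_horoFn [Nonempty (Fin n)] :
    ContinuousOn (horoFn (n := n)) (Metric.closedBall 0 1) := by
  refine continuousOn_pi.2 fun x => ContinuousOn.log (Continuous.continuousOn ?_) fun w hw =>
    (norm_horoVec_pos (mem_closedBall_zero_iff.1 hw) x).ne'
  unfold horoVec quadRoot
  fun_prop

/-- An internal function is the horofunction of any `w` whose vectors are proportional to its
ratio vectors. -/
theorem intFn_eq_horoFn [Nonempty (Fin n)] (hw : ‖w‖ ≤ 1) {y : Pos n} {k : ℝ} (hk : 0 < k)
    (h : ∀ x, ratioVec x y = k • horoVec w x) : intFn (dT n) (uPos n) y = horoFn w := by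
  funext x
  have hx := (norm_horoVec_pos hw x).ne'
  simp only [intFn, horoFn, dT_eq_log_norm, h, norm_smul, Real.norm_of_nonneg hk.le,
    norm_horoVec_uPos hw, Real.log_mul hk.ne' hx, mul_one]
  ring

theorem horoFn_mem_range_intFn [Nonempty (Fin n)] (hw : ‖w‖ < 1) :
    horoFn w ∈ Set.range (intFn (dT n) (uPos n)) := by
  have hc : 0 < 1 - ‖w‖ := sub_pos.2 hw
  have hs := Real.sqrt_pos.2 hc
  have hss : √(1 - ‖w‖) ^ 2 = 1 - ‖w‖ := Real.sq_sqrt hc.le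
  have hab := fun i => quadRoot_mul_quadRoot_neg hc.le (w i)
  have hb : ∀ i, 0 < quadRoot (1 - ‖w‖) (-w i) := fun i =>
    lt_of_le_of_ne (quadRoot_nonneg hc.le _) fun h => by
      have := hab i
      rw [← h, mul_zero] at this
      exact hc.ne this
  refine ⟨⟨fun i => quadRoot (1 - ‖w‖) (-w i) / √(1 - ‖w‖), fun i => div_pos (hb i) hs⟩,
    intFn_eq_horoFn hw.le (inv_pos.2 hs) fun x => ?_⟩
  funext i
  have hx := (x.2 i).ne'
  have hbi := (hb i).ne'
  have hi := hab i
  simp only [ratioVec, horoVec, Pi.smul_apply, Prod.smul_mk, smul_eq_mul, Prod.mk.injEq]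
  generalize √(1 - ‖w‖) = s at *
  generalize quadRoot (1 - ‖w‖) (-w i) = b at *
  generalize quadRoot (1 - ‖w‖) (w i) = a at *
  constructor
  · field_simp
    rw [hss, ← hi]
    ring
  · field_simp

theorem exists_horoFn_eq_intFn [Nonempty (Fin n)] (y : Pos n) :
    ∃ w : Fin n → ℝ, ‖w‖ ≤ 1 ∧ horoFn w = intFn (dT n) (uPos n) y := by
  set R := ‖ratioVec (uPos n) y‖ with hR
  have hR0 : 0 < R := norm_ratioVec_pos _ _
  have hle : ∀ i, (y.1 i)⁻¹ ≤ R ∧ y.1 i ≤ R := fun i => by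
    have h := norm_prod_le_iff.1 (norm_le_pi_norm (ratioVec (uPos n) y) i)
    rw [← hR] at h
    simpa [ratioVec, uPos, abs_of_pos (y.2 i)] using h
  obtain ⟨j, hj⟩ : ∃ j, (y.1 j)⁻¹ = R ∨ y.1 j = R := by
    obtain ⟨j, hj⟩ := exists_norm_apply_eq (ratioVec (uPos n) y)
    refine ⟨j, ?_⟩
    simp only [ratioVec, uPos, Prod.norm_mk, one_div, div_one, norm_inv, Real.norm_eq_abs,
      abs_of_pos (y.2 j)] at hj
    rcases max_choice (y.1 j)⁻¹ (y.1 j) with h | h <;> rw [h] at hj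
    · exact Or.inl hj
    · exact Or.inr hj
  set w : Fin n → ℝ := fun i => (y.1 i)⁻¹ / R - y.1 i / R with hwdef
  have hnorm : ‖w‖ = 1 - (R ^ 2)⁻¹ := by
    have hval : 1 - (R ^ 2)⁻¹ = (R - R⁻¹) / R := by field_simp
    have hwabs : ∀ i, ‖w i‖ = |(y.1 i)⁻¹ - y.1 i| / R := fun i => by
      simp only [hwdef, Real.norm_eq_abs, ← sub_div, abs_div, abs_of_pos hR0]
    rw [hval]
    apply le_antisymm
    · refine (pi_norm_le_iff_of_nonempty _).2 fun i => ?_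
      have h₁ := inv_anti₀ (y.2 i) (hle i).2
      have h₂ := inv_anti₀ (inv_pos.2 (y.2 i)) (hle i).1
      rw [inv_inv] at h₂
      rw [hwabs]
      refine div_le_div_of_nonneg_right (abs_le.2 ⟨?_, ?_⟩) hR0.le
      · linarith [(hle i).2]
      · linarith [(hle i).1]
    · refine le_trans ?_ (norm_le_pi_norm w j)
      rw [hwabs]
      refine div_le_div_of_nonneg_right ?_ hR0.le
      rcases hj with h | h
      · rw [← h, inv_inv]; exact le_abs_self _
      · rw [h, abs_sub_comm]; exact le_abs_self _
  have hw : ‖w‖ ≤ 1 := by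
    rw [hnorm]
    linarith [inv_pos.2 (pow_pos hR0 2)]
  refine ⟨w, hw, (intFn_eq_horoFn hw hR0 fun x => ?_).symm⟩
  funext i
  have hy := y.2 i
  have hc : 1 - ‖w‖ = (y.1 i)⁻¹ / R * (y.1 i / R) := by
    rw [hnorm]
    field_simp
    ring
  have ha : quadRoot (1 - ‖w‖) (w i) = (y.1 i)⁻¹ / R := by
    rw [hc]
    exact quadRoot_mul_sub (by positivity) (by positivity)
  have hb : quadRoot (1 - ‖w‖) (-w i) = y.1 i / R := by
    rw [hc, mul_comm, hwdef, neg_sub]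
    exact quadRoot_mul_sub (by positivity) (by positivity)
  have hx := x.2 i
  simp only [ratioVec, horoVec, Pi.smul_apply, Prod.smul_mk, smul_eq_mul, ha, hb, Prod.mk.injEq]
  constructor <;> field_simp

/-- The point of the orthant with `i`-th coordinate `t` and all other coordinates `1`. -/
noncomputable def coordPos (i : Fin n) (t : ℝ) (ht : 0 < t) : Pos n :=
  ⟨Function.update 1 i t, fun j => by
    rcases eq_or_ne j i with rfl | h
    · simpa
    · simp [h]⟩

theorem norm_horoVec_coordPos_le [Nonempty (Fin n)] (hw : ‖w‖ ≤ 1) (i : Fin n) {t r : ℝ}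
    (ht : 0 < t) (hr : 1 ≤ r) (h₁ : quadRoot (1 - ‖w‖) (w i) * t ≤ r)
    (h₂ : quadRoot (1 - ‖w‖) (-w i) / t ≤ r) : ‖horoVec w (coordPos i t ht)‖ ≤ r := by
  have hc := sub_nonneg.2 hw
  refine (pi_norm_le_iff_of_nonempty _).2 fun j => norm_prod_le_iff.2 ?_
  rcases eq_or_ne j i with rfl | h
  · simpa [horoVec, coordPos, abs_of_nonneg, quadRoot_nonneg hc, abs_of_pos ht] using ⟨h₁, h₂⟩
  · have := quadRoot_one_sub_norm_le_one hw j
    simpa [horoVec, coordPos, h, abs_of_nonneg, quadRoot_nonneg hc] using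
      ⟨this.1.trans hr, this.2.trans hr⟩

theorem quadRoot_le_of_norm_horoVec_eq [Nonempty (Fin n)] {v : Fin n → ℝ} (hw : ‖w‖ ≤ 1)
    (hv : ‖v‖ ≤ 1) (h : ∀ x, ‖horoVec w x‖ = ‖horoVec v x‖) (i : Fin n) :
    quadRoot (1 - ‖w‖) (w i) ≤ quadRoot (1 - ‖v‖) (v i) ∧
      quadRoot (1 - ‖w‖) (-w i) ≤ quadRoot (1 - ‖v‖) (-v i) := by
  have hcv := sub_nonneg.2 hv
  obtain ⟨hw₁, hw₂⟩ := quadRoot_one_sub_norm_le_one hw i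
  obtain ⟨hv₁, hv₂⟩ := quadRoot_one_sub_norm_le_one hv i
  constructor
  · by_contra! hlt
    have ha := (quadRoot_nonneg hcv (v i)).trans_lt hlt
    have ht : 0 < 2 / quadRoot (1 - ‖w‖) (w i) := by positivity
    have hge := (norm_fst_le _).trans (norm_le_pi_norm (horoVec w (coordPos i _ ht)) i)
    rw [h] at hge
    have hlt' : ‖horoVec v (coordPos i _ ht)‖ ≤
        max 1 (quadRoot (1 - ‖v‖) (v i) * (2 / quadRoot (1 - ‖w‖) (w i))) := by
      refine norm_horoVec_coordPos_le hv i ht (le_max_left _ _) (le_max_right _ _) ?_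
      refine le_max_of_le_left ?_
      rw [div_div_eq_mul_div]
      nlinarith [quadRoot_nonneg hcv (-v i)]
    have h2 : ‖(horoVec w (coordPos i _ ht) i).1‖ = 2 := by
      simp [horoVec, coordPos, mul_div_cancel₀, ha.ne']
    rw [h2] at hge
    have : quadRoot (1 - ‖v‖) (v i) * (2 / quadRoot (1 - ‖w‖) (w i)) < 2 := by
      rw [mul_div_assoc', div_lt_iff₀ ha]
      linarith
    exact absurd (hge.trans hlt') (not_le.2 (max_lt (by norm_num) this))
  · by_contra! hlt
    have hb := (quadRoot_nonneg hcv (-v i)).trans_lt hlt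
    have ht : 0 < quadRoot (1 - ‖w‖) (-w i) / 2 := by positivity
    have hge := (norm_snd_le _).trans (norm_le_pi_norm (horoVec w (coordPos i _ ht)) i)
    rw [h] at hge
    have hlt' : ‖horoVec v (coordPos i _ ht)‖ ≤
        max 1 (quadRoot (1 - ‖v‖) (-v i) / (quadRoot (1 - ‖w‖) (-w i) / 2)) := by
      refine norm_horoVec_coordPos_le hv i ht (le_max_left _ _) ?_ (le_max_right _ _)
      refine le_max_of_le_left ?_
      nlinarith [quadRoot_nonneg hcv (v i)]
    have h2 : ‖(horoVec w (coordPos i _ ht) i).2‖ = 2 := by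
      simp [horoVec, coordPos, div_div_cancel₀, hb.ne']
    rw [h2] at hge
    have : quadRoot (1 - ‖v‖) (-v i) / (quadRoot (1 - ‖w‖) (-w i) / 2) < 2 := by
      rw [div_lt_iff₀ ht]
      linarith
    exact absurd (hge.trans hlt') (not_le.2 (max_lt (by norm_num) this))

theorem injOn_horoFn [Nonempty (Fin n)] :
    Set.InjOn (horoFn (n := n)) (Metric.closedBall 0 1) := by
  intro w hw v hv h
  rw [mem_closedBall_zero_iff] at hw hv
  have hN : ∀ x, ‖horoVec w x‖ = ‖horoVec v x‖ := fun x =>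
    Real.log_injOn_pos (norm_horoVec_pos hw x) (norm_horoVec_pos hv x) (congrFun h x)
  funext i
  have h₁ := quadRoot_le_of_norm_horoVec_eq hw hv hN i
  have h₂ := quadRoot_le_of_norm_horoVec_eq hv hw (fun x => (hN x).symm) i
  rw [← quadRoot_sub_quadRoot_neg (1 - ‖w‖) (w i), ← quadRoot_sub_quadRoot_neg (1 - ‖v‖) (v i),
    h₁.1.antisymm h₂.1, h₁.2.antisymm h₂.2]

theorem image_horoFn_closedBall [Nonempty (Fin n)] :
    horoFn '' Metric.closedBall 0 1 = horoCpt (dT n) (uPos n) := by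
  apply Set.Subset.antisymm
  · have hcont := continuousOn_horoFn (n := n)
    rw [← closure_ball _ one_ne_zero] at hcont ⊢
    refine hcont.image_closure.trans (closure_mono ?_)
    rintro _ ⟨w, hw, rfl⟩
    exact horoFn_mem_range_intFn (mem_ball_zero_iff.1 hw)
  · refine closure_minimal ?_
      ((isCompact_closedBall _ _).image_of_continuousOn continuousOn_horoFn).isClosed
    rintro _ ⟨y, rfl⟩
    obtain ⟨w, hw, h⟩ := exists_horoFn_eq_intFn y
    exact ⟨w, mem_closedBall_zero_iff.2 hw, h⟩

end

theorem nonempty_homeomorph_closedBall_crossPolytope (n : ℕ) :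
    Nonempty (Metric.closedBall (0 : Fin n → ℝ) 1 ≃ₜ {y : Fin n → ℝ // ∑ i, |y i| ≤ 1}) := by
  set s : Set (Fin n → ℝ) := {y | ∑ i, |y i| ≤ 1} with hs
  have hcont : Continuous fun y : Fin n → ℝ => ∑ i, |y i| := by fun_prop
  have hclosed : IsClosed s := isClosed_le hcont continuous_const
  have hconv : Convex ℝ s := by
    intro x hx y hy a b ha hb hab
    rw [hs, Set.mem_ofPred_eq] at *
    calc ∑ i, |(a • x + b • y) i| ≤ ∑ i, (a * |x i| + b * |y i|) :=
          Finset.sum_le_sum fun i _ => by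
            simpa [abs_mul, abs_of_nonneg ha, abs_of_nonneg hb] using abs_add_le (a * x i) (b * y i)
      _ = a * ∑ i, |x i| + b * ∑ i, |y i| := by
          rw [Finset.sum_add_distrib, Finset.mul_sum, Finset.mul_sum]
      _ ≤ 1 := by nlinarith
  have hne : (interior s).Nonempty := by
    refine ⟨0, mem_interior_iff_mem_nhds.2 ?_⟩
    exact mem_of_superset ((isOpen_lt hcont continuous_const).mem_nhds (by simp : _ < (1 : ℝ)))
      fun y (hy : ∑ i, |y i| < 1) => hy.le
  have hbdd : Bornology.IsBounded s := by
    refine Metric.isBounded_closedBall (x := 0) (r := 1) |>.subset fun y hy => ?_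
    rw [mem_closedBall_zero_iff, pi_norm_le_iff_of_nonneg zero_le_one]
    exact fun i => (Finset.single_le_sum (f := fun i => |y i|) (fun j _ => abs_nonneg _)
      (Finset.mem_univ i)).trans hy
  obtain ⟨e, -, he, -⟩ :=
    exists_homeomorph_image_interior_closure_frontier_eq_unitBall hconv hne hbdd
  rw [hclosed.closure_eq] at he
  exact ⟨((e.image s).trans (Homeomorph.setCongr he)).symm⟩

theorem stmt3 (n : ℕ) (hn : 1 ≤ n) :
    Nonempty ((horoCpt (dT n) (uPos n)) ≃ₜ {y : Fin n → ℝ // ∑ i, |y i| ≤ 1}) := by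
  have : Nonempty (Fin n) := ⟨⟨0, hn⟩⟩
  have hemb := (continuousOn_horoFn (n := n)).domRestrict.isClosedEmbedding injOn_horoFn.injective
  have hrange : Set.range ((Metric.closedBall 0 1).domRestrict horoFn) =
      horoCpt (dT n) (uPos n) := by
    rw [Set.range_domRestrict, image_horoFn_closedBall]
  obtain ⟨e⟩ := nonempty_homeomorph_closedBall_crossPolytope n
  exact ⟨(hemb.isEmbedding.toHomeomorph.trans (Homeomorph.setCongr hrange)).symm.trans e⟩
end

section
/- A function h : (0,∞)ⁿ → ℝ is a horofunction of ((0,∞)ⁿ, d_T) with basepoint u = (1,…,1) if and only if there exist disjoint subsets I, J ⊆ {1,…,n} with I ∪ J nonempty and real numbers α_k ≥ 0 for k ∈ I ∪ J with min_{k ∈ I∪J} α_k = 0, such that for all x ∈ (0,∞)ⁿ: h(x) = max( max_{i∈I}(−α_i − log x_i), max_{j∈J}(−α_j + log x_j) ), where a maximum over an empty index set is omitted. -/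
open Filter Topology

namespace Pos

/-- Componentwise logarithm. -/
noncomputable def logVec {n : ℕ} (x : Pos n) : Fin n → ℝ := fun i => Real.log (x.1 i)

/-- Componentwise exponential. -/
noncomputable def expVec {n : ℕ} (v : Fin n → ℝ) : Pos n :=
  ⟨fun i => Real.exp (v i), fun _ => Real.exp_pos _⟩

@[simp]
lemma logVec_expVec {n : ℕ} (v : Fin n → ℝ) : logVec (expVec v) = v := by
  funext i
  simp [logVec, expVec]

@[simp]
lemma logVec_uPos (n : ℕ) : logVec (uPos n) = 0 := by
  funext i
  simp [logVec, uPos]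

end Pos

open Pos

lemma dT_nonneg {n : ℕ} (x y : Pos n) : 0 ≤ dT n x y :=
  Real.iSup_nonneg fun _ => abs_nonneg _

lemma abs_logVec_sub_le_dT {n : ℕ} (x y : Pos n) (k : Fin n) :
    |logVec x k - logVec y k| ≤ dT n x y :=
  le_ciSup (f := fun i => |logVec x i - logVec y i|) (Set.finite_range _).bddAbove k

lemma exists_dT_eq {n : ℕ} (hn : 1 ≤ n) (x y : Pos n) :
    ∃ k, dT n x y = logVec x k - logVec y k ∨ dT n x y = logVec y k - logVec x k := by
  have : Nonempty (Fin n) := ⟨⟨0, hn⟩⟩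
  obtain ⟨k, hk⟩ := exists_eq_ciSup_of_finite (f := fun i => |logVec x i - logVec y i|)
  have hk' : dT n x y = |logVec x k - logVec y k| := hk.symm
  refine ⟨k, ?_⟩
  rcases abs_choice (logVec x k - logVec y k) with h | h
  · exact Or.inl (hk'.trans h)
  · exact Or.inr (hk'.trans (h.trans (neg_sub _ _)))

lemma dT_eq_dist {n : ℕ} (hn : 1 ≤ n) (x y : Pos n) :
    dT n x y = dist (logVec x) (logVec y) := by
  have : Nonempty (Fin n) := ⟨⟨0, hn⟩⟩
  apply le_antisymm
  · exact ciSup_le fun k => dist_le_pi_dist (logVec x) (logVec y) k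
  · exact (dist_pi_le_iff (dT_nonneg x y)).2 fun k => abs_logVec_sub_le_dT x y k

/-- Along an ultrafilter, a nonnegative real function either diverges to infinity or
converges. -/
lemma Ultrafilter.tendsto_atTop_or_nhds {X : Type*} (F : Ultrafilter X) (f : X → ℝ)
    (hf : ∀ y, 0 ≤ f y) : Tendsto f F atTop ∨ ∃ a, 0 ≤ a ∧ Tendsto f F (𝓝 a) := by
  rw [or_iff_not_imp_left, tendsto_atTop]
  intro h
  push Not at h
  obtain ⟨c, hc⟩ := h
  have hmem : ∀ᶠ y in (F : Filter X), f y ∈ Set.Icc 0 c := by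
    filter_upwards [hc] with y hy
    exact ⟨hf y, hy.le⟩
  obtain ⟨a, ha, hle⟩ := isCompact_Icc.ultrafilter_le_nhds (F.map f)
    (le_principal_iff.2 hmem)
  exact ⟨a, ha.1, hle⟩

/-- A point in the closure of the range of `f` is a limit of `f` along an ultrafilter. -/
lemma exists_ultrafilter_tendsto_of_mem_closure_range {X Y : Type*} [TopologicalSpace Y]
    {f : X → Y} {a : Y} (ha : a ∈ closure (Set.range f)) :
    ∃ F : Ultrafilter X, Tendsto f F (𝓝 a) := by
  have : (comap f (𝓝 a)).NeBot := comap_neBot fun t ht => by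
    obtain ⟨_, hyt, x, rfl⟩ := mem_closure_iff_nhds.1 ha t ht
    exact ⟨x, hyt⟩
  exact ⟨Ultrafilter.of _, tendsto_comap.mono_left (Ultrafilter.of_le _)⟩

/-- Along an ultrafilter on which the distance to the basepoint converges, the internal
functions converge to an internal function. -/
lemma mem_range_intFn_of_tendsto_dT {n : ℕ} (hn : 1 ≤ n) {h : Pos n → ℝ}
    {F : Ultrafilter (Pos n)} (hF : Tendsto (intFn (dT n) (uPos n)) F (𝓝 h)) {r : ℝ}
    (hr : Tendsto (dT n (uPos n)) F (𝓝 r)) :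
    h ∈ Set.range (intFn (dT n) (uPos n)) := by
  have hmem : ∀ᶠ y in (F : Filter (Pos n)), logVec y ∈ Metric.closedBall 0 (r + 1) := by
    filter_upwards [hr.eventually (eventually_le_nhds (lt_add_one r))] with y hy
    rwa [dT_eq_dist hn, logVec_uPos, dist_comm] at hy
  obtain ⟨v, -, hle⟩ := (isCompact_closedBall (0 : Fin n → ℝ) (r + 1)).ultrafilter_le_nhds
    (F.map logVec) (le_principal_iff.2 hmem)
  have hv : Tendsto logVec F (𝓝 v) := hle
  have hd : ∀ x, Tendsto (dT n x) F (𝓝 (dT n x (expVec v))) := by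
    intro x
    simp only [funext (dT_eq_dist hn x), logVec_expVec]
    exact tendsto_const_nhds.dist hv
  refine ⟨expVec v, funext fun x => ?_⟩
  exact tendsto_nhds_unique ((hd x).sub (hd (uPos n))) (tendsto_pi_nhds.1 hF x)

/-- The maximum of the functions `-α k - log x k` for `k ∈ I` and `-α k + log x k` for
`k ∈ J \ I`. -/
noncomputable def maxFn {n : ℕ} (I J : Finset (Fin n)) (hne : (I ∪ J).Nonempty)
    (α : Fin n → ℝ) (x : Pos n) : ℝ :=
  (I ∪ J).sup' hne fun k => if k ∈ I then -α k - logVec x k else -α k + logVec x k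

/-- A function that is a limit of internal functions along an ultrafilter on which the
distance to the basepoint diverges has the form of a horofunction. -/
lemma exists_eq_maxFn_of_tendsto_dT_atTop {n : ℕ} (hn : 1 ≤ n) {h : Pos n → ℝ}
    {F : Ultrafilter (Pos n)} (hF : Tendsto (intFn (dT n) (uPos n)) F (𝓝 h))
    (hR : Tendsto (dT n (uPos n)) F atTop) :
    ∃ (I J : Finset (Fin n)) (hne : (I ∪ J).Nonempty), Disjoint I J ∧
      ∃ α : Fin n → ℝ, (∀ k ∈ I ∪ J, 0 ≤ α k) ∧ (I ∪ J).inf' hne α = 0 ∧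
        ∀ x, h x = maxFn I J hne α x := by
  classical
  set R := dT n (uPos n) with hRdef
  have habs : ∀ y k, |logVec y k| ≤ R y := fun y k => by
    simpa using abs_logVec_sub_le_dT (uPos n) y k
  have hA := fun k => F.tendsto_atTop_or_nhds (fun y => R y - logVec y k)
    fun y => sub_nonneg.2 (abs_le.1 (habs y k)).2
  have hB := fun k => F.tendsto_atTop_or_nhds (fun y => R y + logVec y k)
    fun y => by linarith [(abs_le.1 (habs y k)).1]
  have hFx := fun x => tendsto_pi_nhds.1 hF x
  let I : Finset (Fin n) := {k | ∃ a, 0 ≤ a ∧ Tendsto (fun y => R y - logVec y k) F (𝓝 a)}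
  let J : Finset (Fin n) := {k | ∃ a, 0 ≤ a ∧ Tendsto (fun y => R y + logVec y k) F (𝓝 a)}
  have hIJ : Disjoint I J := by
    rw [Finset.disjoint_left]
    intro k hI hJ
    obtain ⟨a, -, ha⟩ := (Finset.mem_filter.1 hI).2
    obtain ⟨b, -, hb⟩ := (Finset.mem_filter.1 hJ).2
    refine not_tendsto_nhds_of_tendsto_atTop (hR.atTop_add_atTop hR) (a + b)
      ((ha.add hb).congr fun y => ?_)
    ring
  have hex : ∀ k, ∃ a, (k ∈ I → 0 ≤ a ∧ Tendsto (fun y => R y - logVec y k) F (𝓝 a)) ∧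
      (k ∈ J → 0 ≤ a ∧ Tendsto (fun y => R y + logVec y k) F (𝓝 a)) := by
    intro k
    by_cases hI : k ∈ I
    · obtain ⟨a, ha⟩ := (Finset.mem_filter.1 hI).2
      exact ⟨a, fun _ => ha, fun hJ => absurd hJ (Finset.disjoint_left.1 hIJ hI)⟩
    by_cases hJ : k ∈ J
    · obtain ⟨a, ha⟩ := (Finset.mem_filter.1 hJ).2
      exact ⟨a, fun hI' => absurd hI' hI, fun _ => ha⟩
    · exact ⟨0, fun hI' => absurd hI' hI, fun hJ' => absurd hJ' hJ⟩
  choose α hαI hαJ using hex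
  have hI_lim : ∀ x, ∀ k ∈ I,
      Tendsto (fun y => logVec y k - logVec x k - R y) F (𝓝 (-α k - logVec x k)) := by
    intro x k hk
    refine ((hαI k hk).2.neg.sub_const (logVec x k)).congr fun y => by ring
  have hJ_lim : ∀ x, ∀ k ∈ J,
      Tendsto (fun y => logVec x k - logVec y k - R y) F (𝓝 (-α k + logVec x k)) := by
    intro x k hk
    refine ((hαJ k hk).2.neg.add_const (logVec x k)).congr fun y => by ring
  have attained : ∀ x, ∃ k ∈ I ∪ J,
      h x = if k ∈ I then -α k - logVec x k else -α k + logVec x k := by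
    intro x
    have hev : ∀ᶠ y in (F : Filter (Pos n)), ∃ k, dT n x y = logVec x k - logVec y k ∨
        dT n x y = logVec y k - logVec x k := Eventually.of_forall (exists_dT_eq hn x)
    rw [Ultrafilter.eventually_exists_iff] at hev
    obtain ⟨k, hk⟩ := hev
    rcases Ultrafilter.eventually_or.1 hk with hk | hk
    · have hlim : Tendsto (fun y => logVec x k - logVec y k - R y) F (𝓝 (h x)) :=
        (hFx x).congr' (hk.mono fun y hy => by simp only [intFn, hy, hRdef])
      have hkJ : k ∈ J := by
        rcases hB k with ht | ht
        · refine absurd ((hlim.neg.add_const (logVec x k)).congr fun y => ?_)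
            (not_tendsto_nhds_of_tendsto_atTop ht (-h x + logVec x k))
          ring
        · exact Finset.mem_filter.2 ⟨Finset.mem_univ _, ht⟩
      refine ⟨k, Finset.mem_union_right _ hkJ, ?_⟩
      rw [if_neg (Finset.disjoint_right.1 hIJ hkJ)]
      exact tendsto_nhds_unique hlim (hJ_lim x k hkJ)
    · have hlim : Tendsto (fun y => logVec y k - logVec x k - R y) F (𝓝 (h x)) :=
        (hFx x).congr' (hk.mono fun y hy => by simp only [intFn, hy, hRdef])
      have hkI : k ∈ I := by
        rcases hA k with ht | ht
        · refine absurd ((hlim.neg.sub_const (logVec x k)).congr fun y => ?_)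
            (not_tendsto_nhds_of_tendsto_atTop ht (-h x - logVec x k))
          ring
        · exact Finset.mem_filter.2 ⟨Finset.mem_univ _, ht⟩
      refine ⟨k, Finset.mem_union_left _ hkI, ?_⟩
      rw [if_pos hkI]
      exact tendsto_nhds_unique hlim (hI_lim x k hkI)
  obtain ⟨k₀, hk₀, hk₀u⟩ := attained (uPos n)
  have hu : h (uPos n) = 0 :=
    tendsto_nhds_unique (hFx (uPos n)) (tendsto_const_nhds.congr fun y => by simp [intFn])
  have hα₀ : α k₀ = 0 := by
    rw [hu, logVec_uPos] at hk₀u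
    simpa using hk₀u.symm
  have hα : ∀ k ∈ I ∪ J, 0 ≤ α k := fun k hk =>
    (Finset.mem_union.1 hk).elim (fun hI => (hαI k hI).1) fun hJ => (hαJ k hJ).1
  have hne : (I ∪ J).Nonempty := ⟨k₀, hk₀⟩
  refine ⟨I, J, hne, hIJ, α, hα, ?_, fun x => ?_⟩
  · exact le_antisymm (hα₀ ▸ Finset.inf'_le α hk₀) (Finset.le_inf' hne α hα)
  · apply le_antisymm
    · obtain ⟨k, hk, hkx⟩ := attained x
      rw [hkx]
      exact Finset.le_sup' (fun k => if k ∈ I then -α k - logVec x k else -α k + logVec x k) hk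
    · refine Finset.sup'_le hne _ fun k hk => ?_
      have hle := fun y => abs_le.1 (abs_logVec_sub_le_dT x y k)
      split_ifs with hkI
      · refine le_of_tendsto_of_tendsto' (hI_lim x k hkI) (hFx x) fun y => ?_
        simp only [intFn, hRdef]
        linarith [(hle y).1]
      · refine le_of_tendsto_of_tendsto'
          (hJ_lim x k ((Finset.mem_union.1 hk).resolve_left hkI)) (hFx x) fun y => ?_
        simp only [intFn, hRdef]
        linarith [(hle y).2]

/-- The ray with `log y k = ±(m - α k)` for `k ∈ I ∪ J` and `log y k = 0` elsewhere. -/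
noncomputable def horoRay {n : ℕ} (I J : Finset (Fin n)) (α : Fin n → ℝ) (m : ℝ) : Pos n :=
  expVec fun k => if k ∈ I then m - α k else if k ∈ J then -(m - α k) else 0

lemma eventually_dT_horoRay {n : ℕ} (hn : 1 ≤ n) (I J : Finset (Fin n))
    (hne : (I ∪ J).Nonempty) (α : Fin n → ℝ) (x : Pos n) :
    ∀ᶠ m in atTop, dT n x (horoRay I J α m) = m + maxFn I J hne α x := by
  have : Nonempty (Fin n) := ⟨⟨0, hn⟩⟩
  have hlarge : ∀ᶠ m : ℝ in atTop, ∀ k,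
      |α k| + |logVec x k| + |maxFn I J hne α x| ≤ m :=
    eventually_all.2 fun k => eventually_ge_atTop _
  filter_upwards [hlarge] with m hm
  have hin : ∀ k ∈ I ∪ J, |logVec x k - logVec (horoRay I J α m) k| =
      m + if k ∈ I then -α k - logVec x k else -α k + logVec x k := by
    intro k hk
    have h1 := hm k
    have h2 := le_abs_self (α k)
    have h3 := abs_le.1 (le_refl |logVec x k|)
    have h4 := abs_nonneg (maxFn I J hne α x)
    rw [horoRay, logVec_expVec]
    by_cases hI : k ∈ I
    · simp only [hI, if_true]
      rw [abs_of_nonpos (by linarith [h3.2])]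
      ring
    · simp only [hI, (Finset.mem_union.1 hk).resolve_left hI, if_true, if_false]
      rw [abs_of_nonneg (by linarith [h3.1])]
      ring
  have hle : ∀ k ∈ I ∪ J, (if k ∈ I then -α k - logVec x k else -α k + logVec x k) ≤
      maxFn I J hne α x := fun k hk =>
    Finset.le_sup' (fun k => if k ∈ I then -α k - logVec x k else -α k + logVec x k) hk
  apply le_antisymm
  · refine ciSup_le fun k => ?_
    change |logVec x k - logVec (horoRay I J α m) k| ≤ _
    by_cases hk : k ∈ I ∪ J
    · rw [hin k hk]
      linarith [hle k hk]
    · have hk' := hk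
      rw [Finset.mem_union, not_or] at hk'
      rw [horoRay, logVec_expVec]
      simp only [hk'.1, hk'.2, if_false, sub_zero]
      linarith [hm k, abs_nonneg (α k), neg_abs_le (maxFn I J hne α x)]
  · obtain ⟨k, hk, hkeq⟩ := Finset.exists_mem_eq_sup' hne
      fun k => if k ∈ I then -α k - logVec x k else -α k + logVec x k
    have hk' := abs_logVec_sub_le_dT x (horoRay I J α m) k
    rw [hin k hk] at hk'
    exact (congrArg (m + ·) hkeq).le.trans hk'

lemma maxFn_uPos {n : ℕ} {I J : Finset (Fin n)} {hne : (I ∪ J).Nonempty} {α : Fin n → ℝ}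
    (hα : (I ∪ J).inf' hne α = 0) : maxFn I J hne α (uPos n) = 0 := by
  have hcongr : maxFn I J hne α (uPos n) = (I ∪ J).sup' hne fun k => -α k := by
    simp [maxFn]
  rw [hcongr]
  obtain ⟨k, hk, hkeq⟩ := Finset.exists_mem_eq_inf' hne α
  apply le_antisymm
  · refine Finset.sup'_le hne _ fun j hj => ?_
    linarith [Finset.inf'_le α hj]
  · refine le_trans ?_ (Finset.le_sup' (fun k => -α k) hk)
    linarith

lemma maxFn_mem_horoCpt {n : ℕ} (hn : 1 ≤ n) {I J : Finset (Fin n)}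
    {hne : (I ∪ J).Nonempty} {α : Fin n → ℝ} (hα : (I ∪ J).inf' hne α = 0) :
    maxFn I J hne α ∈ horoCpt (dT n) (uPos n) := by
  refine mem_closure_of_tendsto (b := (atTop : Filter ℝ))
    (f := fun m => intFn (dT n) (uPos n) (horoRay I J α m)) (tendsto_pi_nhds.2 fun x => ?_)
    (Eventually.of_forall fun m => Set.mem_range_self _)
  refine tendsto_const_nhds.congr' ?_
  filter_upwards [eventually_dT_horoRay hn I J hne α x,
    eventually_dT_horoRay hn I J hne α (uPos n)] with m hx hu
  rw [intFn, hx, hu, maxFn_uPos hα]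
  ring

/-- Internal functions are bounded below, while `maxFn` is not. -/
lemma maxFn_notMem_range_intFn {n : ℕ} {I J : Finset (Fin n)} {hne : (I ∪ J).Nonempty}
    {α : Fin n → ℝ} (hα : ∀ k ∈ I ∪ J, 0 ≤ α k) :
    maxFn I J hne α ∉ Set.range (intFn (dT n) (uPos n)) := by
  rintro ⟨y, hy⟩
  set t := dT n (uPos n) y + 1 with ht
  let x : Pos n := expVec fun k => if k ∈ I then t else -t
  have hle : maxFn I J hne α x ≤ -t := by
    refine Finset.sup'_le hne _ fun k hk => ?_
    have := hα k hk
    simp only [x, logVec_expVec]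
    split_ifs <;> linarith
  have hge : -dT n (uPos n) y ≤ intFn (dT n) (uPos n) y x := by
    simp only [intFn]
    linarith [dT_nonneg x y]
  rw [hy] at hge
  linarith

theorem stmt6 (n : ℕ) (hn : 1 ≤ n) (h : Pos n → ℝ) :
    (h ∈ horoCpt (dT n) (uPos n) ∧ h ∉ Set.range (intFn (dT n) (uPos n))) ↔
      ∃ (I J : Finset (Fin n)) (hne : (I ∪ J).Nonempty), Disjoint I J ∧
        ∃ α : Fin n → ℝ, (∀ k ∈ I ∪ J, 0 ≤ α k) ∧ (I ∪ J).inf' hne α = 0 ∧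
          ∀ x : Pos n, h x = (I ∪ J).sup' hne fun k =>
            if k ∈ I then -α k - Real.log (x.1 k) else -α k + Real.log (x.1 k) := by
  constructor
  · rintro ⟨hcl, hnot⟩
    obtain ⟨F, hF⟩ := exists_ultrafilter_tendsto_of_mem_closure_range hcl
    rcases F.tendsto_atTop_or_nhds (dT n (uPos n)) (dT_nonneg (uPos n)) with hR | ⟨r, -, hr⟩
    · exact exists_eq_maxFn_of_tendsto_dT_atTop hn hF hR
    · exact absurd (mem_range_intFn_of_tendsto_dT hn hF hr) hnot
  · rintro ⟨I, J, hne, -, α, hα, hinf, hx⟩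
    obtain rfl : h = maxFn I J hne α := funext hx
    exact ⟨maxFn_mem_horoCpt hn hinf, maxFn_notMem_range_intFn hα⟩
end

section
/- A function h : Π_n(ℂ) → ℝ is a horofunction of (Π_n(ℂ), d_T) with basepoint the identity matrix I if and only if there exist positive semidefinite Hermitian matrices Y and Z with YZ + ZY = 0 and max{‖Y‖, ‖Z‖} = 1 such that for all X ∈ Π_n(ℂ): h(X) = max{ log inf{β > 0 : Y ≤ βX}, log inf{β > 0 : Z ≤ βX^{-1}} }, where ≤ is the Loewner order and the first (respectively second) term is omitted from the maximum when Y = 0 (respectively Z = 0); note that not both Y and Z are zero. -/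
open Filter Topology

open Matrix
open scoped ComplexOrder

/-- The Loewner order on complex matrices: `A ≤ B` iff `B - A` is positive semidefinite. -/
def loe {n : ℕ} (A B : Matrix (Fin n) (Fin n) ℂ) : Prop := (B - A).PosSemidef

/-- The operator norm of a Hermitian matrix: the largest absolute value of an eigenvalue. -/
noncomputable def hermNorm {n : ℕ} {A : Matrix (Fin n) (Fin n) ℂ} (hA : A.IsHermitian) : ℝ :=
  ⨆ i, |hA.eigenvalues i|

/-- `B^{-1/2}` of a positive definite matrix `B`, via the continuous functional calculus. -/
noncomputable def invSqrt {n : ℕ} {B : Matrix (Fin n) (Fin n) ℂ} (hB : B.PosDef) :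
    Matrix (Fin n) (Fin n) ℂ :=
  hB.1.cfc fun x => (Real.sqrt x)⁻¹

lemma cfc_isHermitian {n : ℕ} {A : Matrix (Fin n) (Fin n) ℂ} (hA : A.IsHermitian) (f : ℝ → ℝ) :
    (hA.cfc f).IsHermitian := by
  rw [← hA.cfc_eq]
  exact cfc_predicate f A

lemma conj_isHermitian {n : ℕ} {A B : Matrix (Fin n) (Fin n) ℂ}
    (hA : A.IsHermitian) (hB : B.PosDef) :
    (invSqrt hB * A * invSqrt hB).IsHermitian := by
  have hC : (invSqrt hB).IsHermitian := cfc_isHermitian hB.1 _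
  unfold Matrix.IsHermitian at *
  rw [Matrix.conjTranspose_mul, Matrix.conjTranspose_mul, hA, hC, Matrix.mul_assoc]

/-- The set of positive definite `n × n` complex (Hermitian) matrices. -/
def PDn (n : ℕ) : Type := {A : Matrix (Fin n) (Fin n) ℂ // A.PosDef}

/-- The Thompson distance `d_T(A,B) = ‖log (B^{-1/2} A B^{-1/2})‖` on positive definite
matrices. -/
noncomputable def dTM (n : ℕ) (X Y : PDn n) : ℝ :=
  hermNorm (cfc_isHermitian (conj_isHermitian X.2.1 Y.2) Real.log)

/-- The basepoint: the identity matrix. -/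
noncomputable def uPD (n : ℕ) : PDn n := ⟨1, Matrix.PosDef.one⟩

section Thompson

open scoped MatrixOrder Matrix.Norms.L2Operator

variable {n : ℕ}

lemma hermNorm_eq_norm [Nonempty (Fin n)] {A : Matrix (Fin n) (Fin n) ℂ}
    (hA : A.IsHermitian) : hermNorm hA = ‖A‖ := by
  have hsa : IsSelfAdjoint A := hA
  refine eq_of_forall_ge_iff fun r => ?_
  rcases lt_or_ge r 0 with hr | hr
  · have h0 : 0 ≤ hermNorm hA := Real.iSup_nonneg fun i => abs_nonneg _
    exact ⟨fun h => absurd (h0.trans h) hr.not_ge,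
      fun h => absurd ((norm_nonneg A).trans h) hr.not_ge⟩
  · conv_rhs => rw [← cfc_id ℝ A hsa]
    rw [norm_cfc_le_iff (𝕜 := ℝ) id A hr, hA.spectrum_real_eq_range_eigenvalues, hermNorm,
      ciSup_le_iff (Set.finite_range _).bddAbove]
    simp

lemma Matrix.PosDef.invSqrt_isHermitian {B : Matrix (Fin n) (Fin n) ℂ} (hB : B.PosDef) :
    (invSqrt hB).IsHermitian := cfc_isHermitian hB.1 _

lemma Matrix.PosDef.spectrum_pos {A : Matrix (Fin n) (Fin n) ℂ} (hA : A.PosDef) {x : ℝ}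
    (hx : x ∈ spectrum ℝ A) : 0 < x := by
  rw [hA.1.spectrum_real_eq_range_eigenvalues] at hx
  obtain ⟨i, rfl⟩ := hx
  exact hA.eigenvalues_pos i

lemma Matrix.PosDef.invSqrt_mul_mul_invSqrt {B : Matrix (Fin n) (Fin n) ℂ} (hB : B.PosDef) :
    invSqrt hB * B * invSqrt hB = 1 := by
  have hsa : IsSelfAdjoint B := hB.1
  have hcont : ∀ f : ℝ → ℝ, ContinuousOn f (spectrum ℝ B) := fun f =>
    (Matrix.finite_real_spectrum (A := B)).continuousOn f
  rw [invSqrt, ← hB.1.cfc_eq]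
  conv_lhs => enter [1, 2]; rw [← cfc_id ℝ B hsa]
  rw [← cfc_mul _ _ B (hcont _) (hcont _), ← cfc_mul _ _ B (hcont _) (hcont _),
    ← cfc_const_one ℝ B]
  refine cfc_congr fun x hx => ?_
  have hx' := Real.sqrt_pos.2 (hB.spectrum_pos hx)
  have := Real.mul_self_sqrt (hB.spectrum_pos hx).le
  simp only [id]
  field_simp
  rw [pow_two, this]

lemma Matrix.PosDef.isUnit_invSqrt {B : Matrix (Fin n) (Fin n) ℂ} (hB : B.PosDef) : IsUnit (invSqrt hB) :=
  IsUnit.of_mul_eq_one (B * invSqrt hB) (by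
    rw [← Matrix.mul_assoc, hB.invSqrt_mul_mul_invSqrt])

lemma Matrix.PosDef.invSqrt_conj_le_iff {B : Matrix (Fin n) (Fin n) ℂ} (hB : B.PosDef)
    {A C : Matrix (Fin n) (Fin n) ℂ} :
    invSqrt hB * A * invSqrt hB ≤ invSqrt hB * C * invSqrt hB ↔ A ≤ C := by
  rw [Matrix.le_iff, Matrix.le_iff, ← Matrix.sub_mul, ← Matrix.mul_sub,
    ← Matrix.IsUnit.posSemidef_star_left_conjugate_iff (x := C - A) hB.isUnit_invSqrt,
    Matrix.star_eq_conjTranspose, hB.invSqrt_isHermitian.eq]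

lemma Matrix.PosDef.invSqrt_conj_smul {B : Matrix (Fin n) (Fin n) ℂ} (hB : B.PosDef) (r : ℝ) :
    invSqrt hB * (r • B) * invSqrt hB = algebraMap ℝ _ r := by
  rw [Matrix.mul_smul, Matrix.smul_mul, hB.invSqrt_mul_mul_invSqrt, Algebra.algebraMap_eq_smul_one]

lemma Matrix.PosDef.inv_le_inv_iff {A B : Matrix (Fin n) (Fin n) ℂ} (hA : A.PosDef) (hB : B.PosDef) :
    B⁻¹ ≤ A⁻¹ ↔ A ≤ B := by
  obtain ⟨a, rfl⟩ := hA.isUnit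
  obtain ⟨b, rfl⟩ := hB.isUnit
  rw [← Matrix.coe_units_inv, ← Matrix.coe_units_inv]
  exact CStarAlgebra.inv_le_inv_iff (Matrix.nonneg_iff_posSemidef.2 hB.posSemidef)
    (Matrix.nonneg_iff_posSemidef.2 hA.posSemidef)

lemma Matrix.real_smul_inv (A : Matrix (Fin n) (Fin n) ℂ) {r : ℝ} (hr : r ≠ 0)
    (hA : IsUnit A) : (r • A)⁻¹ = r⁻¹ • A⁻¹ := by
  refine Matrix.inv_eq_right_inv ?_
  rw [Matrix.smul_mul, Matrix.mul_smul, smul_smul, mul_inv_cancel₀ hr, one_smul,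
    Matrix.mul_nonsing_inv _ ((Matrix.isUnit_iff_isUnit_det _).1 hA)]

lemma Matrix.PosDef.real_smul {A : Matrix (Fin n) (Fin n) ℂ} (hA : A.PosDef) {r : ℝ} (hr : 0 < r) :
    (r • A).PosDef := hA.smul hr

lemma Matrix.PosDef.norm_cfc_log_le_iff {T : Matrix (Fin n) (Fin n) ℂ} (hT : T.PosDef) {r : ℝ}
    (hr : 0 ≤ r) : ‖cfc Real.log T‖ ≤ r ↔
      algebraMap ℝ _ (Real.exp r)⁻¹ ≤ T ∧ T ≤ algebraMap ℝ _ (Real.exp r) := by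
  have hsa : IsSelfAdjoint T := hT.1
  have hcont : ContinuousOn Real.log (spectrum ℝ T) :=
    (Matrix.finite_real_spectrum (A := T)).continuousOn _
  rw [norm_cfc_le_iff Real.log T hr hcont hsa, le_algebraMap_iff_spectrum_le hsa,
    algebraMap_le_iff_le_spectrum hsa, ← forall₂_and]
  refine forall₂_congr fun x hx => ?_
  have hx0 := hT.spectrum_pos hx
  rw [Real.norm_eq_abs, abs_le, ← Real.exp_neg, Real.le_log_iff_exp_le hx0,
    Real.log_le_iff_le_exp hx0]

lemma Matrix.PosDef.invSqrt_conj {A B : Matrix (Fin n) (Fin n) ℂ} (hA : A.PosDef) (hB : B.PosDef) :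
    (invSqrt hB * A * invSqrt hB).PosDef := by
  have := (Matrix.IsUnit.posDef_star_left_conjugate_iff hB.isUnit_invSqrt).2 hA
  rwa [Matrix.star_eq_conjTranspose, hB.invSqrt_isHermitian.eq] at this

lemma dTM_le_iff [Nonempty (Fin n)] (X W : PDn n) {r : ℝ} (hr : 0 ≤ r) :
    dTM n X W ≤ r ↔ W.1 ≤ Real.exp r • X.1 ∧ W.1⁻¹ ≤ Real.exp r • X.1⁻¹ := by
  obtain ⟨A, hA⟩ := X
  obtain ⟨B, hB⟩ := W
  have he := Real.exp_pos r
  change hermNorm (cfc_isHermitian (conj_isHermitian hA.1 hB) Real.log) ≤ r ↔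
    B ≤ Real.exp r • A ∧ B⁻¹ ≤ Real.exp r • A⁻¹
  rw [hermNorm_eq_norm, ← Matrix.IsHermitian.cfc_eq, (hA.invSqrt_conj hB).norm_cfc_log_le_iff hr,
    ← hB.invSqrt_conj_smul, ← hB.invSqrt_conj_smul, hB.invSqrt_conj_le_iff,
    hB.invSqrt_conj_le_iff, inv_smul_le_iff_of_pos he,
    ← hA.inv_le_inv_iff (hB.real_smul he), Matrix.real_smul_inv _ he.ne' hB.isUnit,
    inv_smul_le_iff_of_pos he]

/-- The inverse of a positive definite matrix, as a positive definite matrix. -/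
noncomputable def PDn.inv (X : PDn n) : PDn n := ⟨X.1⁻¹, X.2.inv⟩

/-- The order-unit norm of a matrix with respect to a positive definite matrix `X`. -/
noncomputable def PDn.gauge (X : PDn n) (Y : Matrix (Fin n) (Fin n) ℂ) : ℝ :=
  ‖invSqrt X.2 * Y * invSqrt X.2‖

lemma PDn.gauge_nonneg (X : PDn n) (Y : Matrix (Fin n) (Fin n) ℂ) : 0 ≤ X.gauge Y :=
  norm_nonneg _

lemma PDn.continuous_gauge (X : PDn n) : Continuous X.gauge := by
  unfold PDn.gauge
  fun_prop

lemma PDn.gauge_smul (X : PDn n) {c : ℝ} (hc : 0 ≤ c) (Y : Matrix (Fin n) (Fin n) ℂ) :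
    X.gauge (c • Y) = c * X.gauge Y := by
  rw [gauge, gauge, Matrix.mul_smul, Matrix.smul_mul, norm_smul, Real.norm_of_nonneg hc]

lemma PDn.gauge_eq_zero_iff (X : PDn n) {Y : Matrix (Fin n) (Fin n) ℂ} :
    X.gauge Y = 0 ↔ Y = 0 := by
  rw [gauge, norm_eq_zero, X.2.isUnit_invSqrt.mul_left_eq_zero,
    X.2.isUnit_invSqrt.mul_right_eq_zero]

lemma PDn.gauge_le_iff (X : PDn n) {Y : Matrix (Fin n) (Fin n) ℂ} (hY : 0 ≤ Y) {β : ℝ}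
    (hβ : 0 ≤ β) : X.gauge Y ≤ β ↔ Y ≤ β • X.1 := by
  have hpos : 0 ≤ invSqrt X.2 * Y * invSqrt X.2 := by
    have := (X.2.invSqrt_conj_le_iff (A := 0) (C := Y)).2 hY
    simpa using this
  rw [gauge, CStarAlgebra.norm_le_iff_le_algebraMap _ hβ hpos, ← X.2.invSqrt_conj_smul,
    X.2.invSqrt_conj_le_iff]

lemma PDn.sInf_eq_gauge (X : PDn n) {Y : Matrix (Fin n) (Fin n) ℂ} (hY : 0 ≤ Y) :
    sInf {β : ℝ | 0 < β ∧ loe Y (β • X.1)} = X.gauge Y := by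
  have hset : {β : ℝ | 0 < β ∧ loe Y (β • X.1)} = {β : ℝ | 0 < β ∧ X.gauge Y ≤ β} := by
    ext β
    exact and_congr_right fun hβ => (X.gauge_le_iff hY hβ.le).symm
  rw [hset]
  rcases (X.gauge_nonneg Y).eq_or_lt with h0 | h0
  · rw [← h0]
    have : {β : ℝ | 0 < β ∧ 0 ≤ β} = Set.Ioi 0 :=
      Set.ext fun β => ⟨fun h => h.1, fun h => ⟨h, le_of_lt h⟩⟩
    rw [this, csInf_Ioi]
  · have : {β : ℝ | 0 < β ∧ X.gauge Y ≤ β} = Set.Ici (X.gauge Y) :=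
      Set.ext fun β => ⟨fun h => h.2, fun h => ⟨h0.trans_le h, h⟩⟩
    rw [this, csInf_Ici]

lemma PDn.gauge_uPD {Y : Matrix (Fin n) (Fin n) ℂ} (hY : 0 ≤ Y) : (uPD n).gauge Y = ‖Y‖ := by
  refine eq_of_forall_ge_iff fun r => ?_
  rcases lt_or_ge r 0 with hr | hr
  · exact ⟨fun h => absurd ((PDn.gauge_nonneg _ _).trans h) hr.not_ge,
      fun h => absurd ((norm_nonneg _).trans h) hr.not_ge⟩
  · rw [PDn.gauge_le_iff _ hY hr, CStarAlgebra.norm_le_iff_le_algebraMap _ hr hY,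
      Algebra.algebraMap_eq_smul_one]
    rfl

lemma PDn.inv_uPD : (uPD n).inv = uPD n := Subtype.ext inv_one

/-- The function `exp ∘ h` of the horofunction `h` determined by `Y` and `Z`. -/
noncomputable def PDn.maxGauge (X : PDn n)
    (p : Matrix (Fin n) (Fin n) ℂ × Matrix (Fin n) (Fin n) ℂ) : ℝ :=
  max (X.gauge p.1) (X.inv.gauge p.2)

lemma PDn.continuous_maxGauge (X : PDn n) : Continuous X.maxGauge :=
  (X.continuous_gauge.comp continuous_fst).max (X.inv.continuous_gauge.comp continuous_snd)

lemma PDn.maxGauge_smul (X : PDn n) {c : ℝ} (hc : 0 ≤ c)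
    (p : Matrix (Fin n) (Fin n) ℂ × Matrix (Fin n) (Fin n) ℂ) :
    X.maxGauge (c • p) = c * X.maxGauge p := by
  rw [maxGauge, maxGauge, mul_max_of_nonneg _ _ hc, Prod.smul_fst, Prod.smul_snd,
    gauge_smul _ hc, gauge_smul _ hc]

lemma PDn.maxGauge_pos (X : PDn n)
    {p : Matrix (Fin n) (Fin n) ℂ × Matrix (Fin n) (Fin n) ℂ} (hp : p ≠ 0) :
    0 < X.maxGauge p := by
  by_contra! hle
  have h1 := (le_max_left _ _).trans hle
  have h2 := (le_max_right _ _).trans hle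
  exact hp (Prod.ext (X.gauge_eq_zero_iff.1 (h1.antisymm (X.gauge_nonneg _)))
    (X.inv.gauge_eq_zero_iff.1 (h2.antisymm (X.inv.gauge_nonneg _))))

lemma PDn.maxGauge_uPD {p : Matrix (Fin n) (Fin n) ℂ × Matrix (Fin n) (Fin n) ℂ} (hp : 0 ≤ p) :
    (uPD n).maxGauge p = ‖p‖ := by
  rw [maxGauge, inv_uPD, gauge_uPD hp.1, gauge_uPD hp.2, Prod.norm_def]

lemma PDn.coe_nonneg (X : PDn n) : 0 ≤ X.1 := Matrix.nonneg_iff_posSemidef.2 X.2.posSemidef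

lemma PDn.coe_inv_nonneg (X : PDn n) : 0 ≤ X.1⁻¹ := X.inv.coe_nonneg

lemma PDn.coe_ne_zero [Nonempty (Fin n)] (X : PDn n) : X.1 ≠ 0 := X.2.isUnit.ne_zero

lemma PDn.mul_inv_self (X : PDn n) : X.1 * X.1⁻¹ = 1 :=
  Matrix.mul_nonsing_inv _ ((Matrix.isUnit_iff_isUnit_det _).1 X.2.isUnit)

lemma dTM_nonneg (X W : PDn n) : 0 ≤ dTM n X W := Real.iSup_nonneg fun _ => abs_nonneg _

/-- The Thompson distance in terms of gauges. -/
lemma dTM_eq_log_maxGauge [Nonempty (Fin n)] (X W : PDn n) :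
    dTM n X W = Real.log (X.maxGauge (W.1, W.1⁻¹)) := by
  have hp : (W.1, W.1⁻¹) ≠ 0 := fun h => W.coe_ne_zero (congrArg Prod.fst h)
  have hpos := X.maxGauge_pos hp
  have key : ∀ r : ℝ, 0 ≤ r → (dTM n X W ≤ r ↔ Real.log (X.maxGauge (W.1, W.1⁻¹)) ≤ r) := by
    intro r hr
    rw [dTM_le_iff X W hr, Real.log_le_iff_le_exp hpos, PDn.maxGauge, max_le_iff,
      PDn.gauge_le_iff _ W.coe_nonneg (Real.exp_pos r).le,
      PDn.gauge_le_iff _ W.coe_inv_nonneg (Real.exp_pos r).le]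
    rfl
  have hlog : 0 ≤ Real.log (X.maxGauge (W.1, W.1⁻¹)) := by
    refine Real.log_nonneg ?_
    by_contra! hlt
    set s := X.maxGauge (W.1, W.1⁻¹) with hs
    have h1 : W.1 ≤ s • X.1 :=
      (X.gauge_le_iff W.coe_nonneg hpos.le).1 (le_max_left _ _)
    have h2 : W.1⁻¹ ≤ s • X.1⁻¹ :=
      (X.inv.gauge_le_iff W.coe_inv_nonneg hpos.le).1 (le_max_right _ _)
    have h3 : X.1 ≤ s • W.1 := by
      rw [← X.2.inv_le_inv_iff (W.2.real_smul hpos), Matrix.real_smul_inv _ hpos.ne' W.2.isUnit,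
        inv_smul_le_iff_of_pos hpos]
      exact h2
    have h4 : X.gauge W.1 ≤ s * s * X.gauge W.1 := by
      have hW : 0 ≤ X.gauge W.1 := X.gauge_nonneg _
      have h5 : W.1 ≤ X.gauge W.1 • X.1 := (X.gauge_le_iff W.coe_nonneg hW).1 le_rfl
      refine (X.gauge_le_iff W.coe_nonneg (by positivity)).2 ?_
      calc W.1 ≤ s • X.1 := h1
        _ ≤ s • s • W.1 := smul_le_smul_of_nonneg_left h3 hpos.le
        _ ≤ s • s • X.gauge W.1 • X.1 :=
          smul_le_smul_of_nonneg_left (smul_le_smul_of_nonneg_left h5 hpos.le) hpos.le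
        _ = (s * s * X.gauge W.1) • X.1 := by rw [smul_smul, smul_smul, mul_assoc]
    have h6 : 0 < X.gauge W.1 :=
      (X.gauge_nonneg _).lt_of_ne' fun h => W.coe_ne_zero (X.gauge_eq_zero_iff.1 h)
    have h7 : s * s < 1 := by nlinarith
    nlinarith [mul_pos h6 (sub_pos.2 h7)]
  exact le_antisymm ((key _ hlog).2 le_rfl) ((key _ (dTM_nonneg X W)).1 le_rfl)

lemma intFn_eq [Nonempty (Fin n)] (W X : PDn n) :
    intFn (dTM n) (uPD n) W X =
      Real.log (X.maxGauge (W.1, W.1⁻¹)) - Real.log ((uPD n).maxGauge (W.1, W.1⁻¹)) := by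
  rw [intFn, dTM_eq_log_maxGauge, dTM_eq_log_maxGauge]

/-- Rescaling the pair `(W, W⁻¹)` does not affect the internal function of `W`. -/
lemma intFn_eq_smul [Nonempty (Fin n)] (W X : PDn n) {c : ℝ} (hc : 0 < c) :
    intFn (dTM n) (uPD n) W X = Real.log (X.maxGauge (c • (W.1, W.1⁻¹))) -
      Real.log ((uPD n).maxGauge (c • (W.1, W.1⁻¹))) := by
  have hp : (W.1, W.1⁻¹) ≠ 0 := fun h => W.coe_ne_zero (congrArg Prod.fst h)
  rw [intFn_eq, PDn.maxGauge_smul _ hc.le, PDn.maxGauge_smul _ hc.le,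
    Real.log_mul hc.ne' (X.maxGauge_pos hp).ne', Real.log_mul hc.ne' (PDn.maxGauge_pos _ hp).ne']
  ring

/-- The triples `(c, Y, Z)` with `Y` and `Z` positive semidefinite, `max ‖Y‖ ‖Z‖ = 1` and
`Y * Z = c • 1`, where `0 ≤ c ≤ 1`. -/
def horoPairs (n : ℕ) :
    Set (ℝ × (Matrix (Fin n) (Fin n) ℂ × Matrix (Fin n) (Fin n) ℂ)) :=
  {q | q.1 ∈ Set.Icc 0 1 ∧ q.2 ∈ Metric.sphere 0 1 ∧ 0 ≤ q.2.1 ∧ 0 ≤ q.2.2 ∧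
    q.2.1 * q.2.2 = q.1 • 1}

lemma isCompact_horoPairs : IsCompact (horoPairs n) := by
  have : ProperSpace (Matrix (Fin n) (Fin n) ℂ) := FiniteDimensional.proper ℂ _
  refine IsCompact.of_isClosed_subset (isCompact_Icc.prod (isCompact_sphere 0 1)) ?_
    (fun q hq => ⟨hq.1, hq.2.1⟩)
  have hnn := CStarAlgebra.isClosed_nonneg (A := Matrix (Fin n) (Fin n) ℂ)
  refine (isClosed_Icc.preimage continuous_fst).inter <|
    (Metric.isClosed_sphere.preimage continuous_snd).inter <|
    (hnn.preimage (by fun_prop)).inter <| (hnn.preimage (by fun_prop)).inter <|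
    isClosed_eq (by fun_prop) (by fun_prop)

lemma isClosed_image_horoPairs :
    IsClosed ((fun q (X : PDn n) => Real.log (X.maxGauge q.2)) '' horoPairs n) := by
  refine (isCompact_horoPairs.image_of_continuousOn ?_).isClosed
  refine continuousOn_pi.2 fun X => ContinuousOn.log
    (X.continuous_maxGauge.comp continuous_snd).continuousOn fun q hq => ?_
  exact (X.maxGauge_pos (ne_of_mem_of_not_mem hq.2.1 (by simp))).ne'

lemma intFn_mem_image_horoPairs [Nonempty (Fin n)] (W : PDn n) :
    intFn (dTM n) (uPD n) W ∈ (fun q (X : PDn n) => Real.log (X.maxGauge q.2)) '' horoPairs n := by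
  have hp : (W.1, W.1⁻¹) ≠ 0 := fun h => W.coe_ne_zero (congrArg Prod.fst h)
  have hs : 0 < ‖(W.1, W.1⁻¹)‖ := norm_pos_iff.2 hp
  set s := ‖(W.1, W.1⁻¹)‖ with hsdef
  have hsi : 0 < s⁻¹ := inv_pos.2 hs
  have hnorm : ‖s⁻¹ • (W.1, W.1⁻¹)‖ = 1 := by
    rw [norm_smul, Real.norm_of_nonneg hsi.le, ← hsdef, inv_mul_cancel₀ hs.ne']
  have h1 : 0 ≤ s⁻¹ • W.1 := smul_nonneg hsi.le W.coe_nonneg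
  have h2 : 0 ≤ s⁻¹ • W.1⁻¹ := smul_nonneg hsi.le W.coe_inv_nonneg
  have hmul : (s⁻¹ • W.1) * (s⁻¹ • W.1⁻¹) = (s⁻¹ * s⁻¹) • 1 := by
    rw [Matrix.smul_mul, Matrix.mul_smul, W.mul_inv_self, smul_smul]
  refine ⟨(s⁻¹ * s⁻¹, s⁻¹ • (W.1, W.1⁻¹)),
    ⟨⟨by positivity, ?_⟩, by simpa using hnorm, h1, h2, hmul⟩, ?_⟩
  · have h3 := norm_mul_le (s⁻¹ • W.1) (s⁻¹ • W.1⁻¹)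
    rw [hmul, norm_smul, norm_one, mul_one, Real.norm_of_nonneg (by positivity)] at h3
    exact h3.trans (mul_le_one₀ ((norm_fst_le (s⁻¹ • (W.1, W.1⁻¹))).trans hnorm.le)
      (norm_nonneg _) ((norm_snd_le (s⁻¹ • (W.1, W.1⁻¹))).trans hnorm.le))
  · funext X
    rw [intFn_eq_smul W X hsi, PDn.maxGauge_uPD ⟨h1, h2⟩, hnorm, Real.log_one, sub_zero]

/-- Pairs of positive semidefinite matrices whose product is a nonzero scalar give internal
functions. -/
lemma log_maxGauge_mem_range [Nonempty (Fin n)] {c : ℝ} (hc : 0 < c)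
    {p : Matrix (Fin n) (Fin n) ℂ × Matrix (Fin n) (Fin n) ℂ} (hp : 0 ≤ p) (hnorm : ‖p‖ = 1)
    (hmul : p.1 * p.2 = c • 1) :
    (fun X : PDn n => Real.log (X.maxGauge p)) ∈ Set.range (intFn (dTM n) (uPD n)) := by
  have hr : 0 < √c := Real.sqrt_pos.2 hc
  have hinv : ((√c)⁻¹ • p.1) * ((√c)⁻¹ • p.2) = 1 := by
    rw [Matrix.smul_mul, Matrix.mul_smul, hmul, smul_smul, smul_smul, ← mul_inv,
      Real.mul_self_sqrt hc.le, inv_mul_cancel₀ hc.ne', one_smul]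
  have hpd : ((√c)⁻¹ • p.1).PosDef := by
    rw [Matrix.PosSemidef.posDef_iff_isUnit]
    · exact IsUnit.of_mul_eq_one _ hinv
    · exact Matrix.nonneg_iff_posSemidef.1 (smul_nonneg (inv_pos.2 hr).le hp.1)
  refine ⟨⟨_, hpd⟩, funext fun X => ?_⟩
  have hpair : √c • ((√c)⁻¹ • p.1, ((√c)⁻¹ • p.1)⁻¹) = p := by
    rw [Matrix.inv_eq_right_inv hinv, ← Prod.smul_mk, smul_smul, mul_inv_cancel₀ hr.ne', one_smul]
  have := intFn_eq_smul ⟨_, hpd⟩ X hr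
  rw [hpair] at this
  rw [this, PDn.maxGauge_uPD hp, hnorm, Real.log_one, sub_zero]

lemma mul_eq_zero_symm_of_nonneg {Y Z : Matrix (Fin n) (Fin n) ℂ} (hY : 0 ≤ Y) (hZ : 0 ≤ Z)
    (h : Y * Z = 0) : Z * Y = 0 := by
  have := congrArg star h
  rwa [star_mul, (IsSelfAdjoint.of_nonneg hY).star_eq, (IsSelfAdjoint.of_nonneg hZ).star_eq,
    star_zero] at this

lemma mul_eq_zero_of_anticommute {Y Z : Matrix (Fin n) (Fin n) ℂ}
    (hY : 0 ≤ Y) (hZ : 0 ≤ Z) (h : Y * Z + Z * Y = 0) : Y * Z = 0 := by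
  obtain ⟨A, rfl⟩ := CStarAlgebra.nonneg_iff_eq_star_mul_self.1 hY
  obtain ⟨B, rfl⟩ := CStarAlgebra.nonneg_iff_eq_star_mul_self.1 hZ
  have htr : ((A * star B)ᴴ * (A * star B)).trace = 0 := by
    have h1 := congrArg Matrix.trace h
    rw [Matrix.trace_add, Matrix.trace_mul_comm (star B * B), Matrix.trace_zero,
      add_self_eq_zero] at h1
    rw [← Matrix.star_eq_conjTranspose, star_mul, star_star, ← h1, Matrix.trace_mul_comm,
      Matrix.mul_assoc (star A), Matrix.trace_mul_comm (star A)]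
    simp only [Matrix.mul_assoc]
  have h0 := Matrix.trace_conjTranspose_mul_self_eq_zero_iff.1 htr
  calc star A * A * (star B * B) = star A * (A * star B) * B := by simp only [Matrix.mul_assoc]
    _ = 0 := by rw [h0, Matrix.mul_zero, Matrix.zero_mul]

lemma posDef_add_smul_one {Y : Matrix (Fin n) (Fin n) ℂ} (hY : 0 ≤ Y) {ε : ℝ} (hε : 0 < ε) :
    (Y + ε • 1).PosDef :=
  Matrix.PosDef.posSemidef_add (Matrix.nonneg_iff_posSemidef.1 hY)
    (Matrix.PosDef.one.real_smul hε)

lemma norm_sq_smul_inv_add_smul_one_le {Y : Matrix (Fin n) (Fin n) ℂ} (hY : 0 ≤ Y) {ε : ℝ}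
    (hε : 0 < ε) : ‖(ε * ε) • (Y + ε • 1)⁻¹‖ ≤ ε := by
  have hpd := posDef_add_smul_one hY hε
  have h1 : (Y + ε • 1)⁻¹ ≤ ε⁻¹ • 1 := by
    have := ((Matrix.PosDef.one.real_smul hε).inv_le_inv_iff hpd).2 (le_add_of_nonneg_left hY)
    rwa [Matrix.real_smul_inv _ hε.ne' isUnit_one, inv_one] at this
  have h2 : 0 ≤ (ε * ε) • (Y + ε • 1)⁻¹ :=
    smul_nonneg (by positivity) (Matrix.nonneg_iff_posSemidef.2 hpd.inv.posSemidef)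
  rw [CStarAlgebra.norm_le_iff_le_algebraMap _ hε.le h2, Algebra.algebraMap_eq_smul_one]
  calc (ε * ε) • (Y + ε • 1)⁻¹ ≤ (ε * ε) • ε⁻¹ • 1 :=
        smul_le_smul_of_nonneg_left h1 (by positivity)
    _ = ε • 1 := by rw [smul_smul, mul_assoc, mul_inv_cancel₀ hε.ne', mul_one]

lemma add_sq_smul_inv_eq {Y Z : Matrix (Fin n) (Fin n) ℂ} (hZ : 0 ≤ Z) (h : Y * Z = 0)
    {ε : ℝ} (hε : 0 < ε) :
    Y + (ε * ε) • (Z + ε • 1)⁻¹ = ε • ((Y + ε • 1) * (Z + ε • 1)⁻¹) := by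
  have hu := (Matrix.isUnit_iff_isUnit_det _).1 (posDef_add_smul_one hZ hε).isUnit
  have h1 : Y = ε • (Y * (Z + ε • 1)⁻¹) := by
    calc Y = Y * (Z + ε • 1) * (Z + ε • 1)⁻¹ := by
          rw [Matrix.mul_assoc, Matrix.mul_nonsing_inv _ hu, Matrix.mul_one]
      _ = ε • (Y * (Z + ε • 1)⁻¹) := by
          rw [Matrix.mul_add, h, zero_add, Matrix.mul_smul, Matrix.mul_one, Matrix.smul_mul]
  conv_lhs => rw [h1]
  rw [Matrix.add_mul, smul_add, Matrix.smul_mul, Matrix.one_mul, smul_smul]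

/-- A pair of positive semidefinite matrices with product zero is a limit of multiples of pairs
`(W, W⁻¹)`, and the multiples can be chosen above the given pair. -/
lemma exists_approx_of_mul_eq_zero {Y Z : Matrix (Fin n) (Fin n) ℂ} (hY : 0 ≤ Y) (hZ : 0 ≤ Z)
    (h : Y * Z = 0) {ε : ℝ} (hε : 0 < ε) :
    ∃ W : PDn n, Y ≤ ε • W.1 ∧ Z ≤ ε • W.1⁻¹ ∧ ‖ε • (W.1, W.1⁻¹) - (Y, Z)‖ ≤ ε := by
  have h' := mul_eq_zero_symm_of_nonneg hY hZ h
  have hA := posDef_add_smul_one hZ hε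
  have hB := posDef_add_smul_one hY hε
  have hAu := (Matrix.isUnit_iff_isUnit_det _).1 hA.isUnit
  have hBu := (Matrix.isUnit_iff_isUnit_det _).1 hB.isUnit
  have eY := add_sq_smul_inv_eq hZ h hε
  have eZ := add_sq_smul_inv_eq hY h' hε
  have hA0 : 0 ≤ (ε * ε) • (Z + ε • 1)⁻¹ :=
    smul_nonneg (by positivity) (Matrix.nonneg_iff_posSemidef.2 hA.inv.posSemidef)
  have hB0 : 0 ≤ (ε * ε) • (Y + ε • 1)⁻¹ :=
    smul_nonneg (by positivity) (Matrix.nonneg_iff_posSemidef.2 hB.inv.posSemidef)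
  have hmul : (Y + ε • 1) * (Z + ε • 1)⁻¹ * ((Z + ε • 1) * (Y + ε • 1)⁻¹) = 1 := by
    rw [Matrix.mul_assoc, ← Matrix.mul_assoc _ (Z + ε • 1), Matrix.nonsing_inv_mul _ hAu,
      Matrix.one_mul, Matrix.mul_nonsing_inv _ hBu]
  have hW : ((Y + ε • 1) * (Z + ε • 1)⁻¹).PosDef := by
    rw [Matrix.PosSemidef.posDef_iff_isUnit]
    · exact IsUnit.of_mul_eq_one _ hmul
    · refine Matrix.nonneg_iff_posSemidef.1 ?_
      refine (smul_le_smul_iff_of_pos_left hε).1 ?_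
      rw [smul_zero, ← eY]
      exact add_nonneg hY hA0
  refine ⟨⟨_, hW⟩, ?_⟩
  rw [Matrix.inv_eq_right_inv hmul, Prod.smul_mk, ← eY, ← eZ]
  refine ⟨le_add_of_nonneg_right hA0, le_add_of_nonneg_right hB0, ?_⟩
  rw [Prod.mk_sub_mk, add_sub_cancel_left, add_sub_cancel_left]
  exact max_le (norm_sq_smul_inv_add_smul_one_le hZ hε) (norm_sq_smul_inv_add_smul_one_le hY hε)

lemma log_maxGauge_mem_horoCpt [Nonempty (Fin n)] {Y Z : Matrix (Fin n) (Fin n) ℂ}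
    (hY : 0 ≤ Y) (hZ : 0 ≤ Z) (h : Y * Z = 0) (hnorm : ‖(Y, Z)‖ = 1) :
    (fun X : PDn n => Real.log (X.maxGauge (Y, Z))) ∈ horoCpt (dTM n) (uPD n) := by
  have hp : (Y, Z) ≠ 0 := norm_ne_zero_iff.1 (by rw [hnorm]; exact one_ne_zero)
  have hε : ∀ k : ℕ, 0 < 1 / ((k : ℝ) + 1) := fun k => Nat.one_div_pos_of_nat
  choose W _ _ hW using fun k : ℕ => exists_approx_of_mul_eq_zero hY hZ h (hε k)
  have hlim : Tendsto (fun k : ℕ => (1 / ((k : ℝ) + 1)) • ((W k).1, (W k).1⁻¹)) atTop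
      (𝓝 (Y, Z)) :=
    tendsto_iff_norm_sub_tendsto_zero.2
      (squeeze_zero (fun _ => norm_nonneg _) hW tendsto_one_div_add_atTop_nhds_zero_nat)
  have hlog : ∀ X : PDn n, Tendsto
      (fun k : ℕ => Real.log (X.maxGauge ((1 / ((k : ℝ) + 1)) • ((W k).1, (W k).1⁻¹)))) atTop
      (𝓝 (Real.log (X.maxGauge (Y, Z)))) := fun X =>
    ((X.continuous_maxGauge.tendsto _).comp hlim).log (X.maxGauge_pos hp).ne'
  refine mem_closure_of_tendsto (f := fun k => intFn (dTM n) (uPD n) (W k)) (b := atTop)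
    (tendsto_pi_nhds.2 fun X => ?_) (Eventually.of_forall fun k => ⟨W k, rfl⟩)
  have := (hlog X).sub (hlog (uPD n))
  rw [PDn.maxGauge_uPD ⟨hY, hZ⟩, hnorm, Real.log_one, sub_zero] at this
  exact this.congr fun k => (intFn_eq_smul (W k) X (hε k)).symm

lemma log_maxGauge_notMem_range [Nonempty (Fin n)] {Y Z : Matrix (Fin n) (Fin n) ℂ}
    (hY : 0 ≤ Y) (hZ : 0 ≤ Z) (h : Y * Z = 0) (hnorm : ‖(Y, Z)‖ = 1) :
    (fun X : PDn n => Real.log (X.maxGauge (Y, Z))) ∉ Set.range (intFn (dTM n) (uPD n)) := by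
  rintro ⟨V, hV⟩
  have hp : (Y, Z) ≠ 0 := norm_ne_zero_iff.1 (by rw [hnorm]; exact one_ne_zero)
  set r := dTM n (uPD n) V with hr
  have hε := Real.exp_pos (-(r + 1))
  obtain ⟨X, hXY, hXZ, -⟩ := exists_approx_of_mul_eq_zero hY hZ h hε
  have h1 : Real.log (X.maxGauge (Y, Z)) ≤ -(r + 1) := by
    rw [Real.log_le_iff_le_exp (X.maxGauge_pos hp)]
    exact max_le ((X.gauge_le_iff hY hε.le).2 hXY) ((X.inv.gauge_le_iff hZ hε.le).2 hXZ)
  have h2 : intFn (dTM n) (uPD n) V X = Real.log (X.maxGauge (Y, Z)) := congrFun hV X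
  have h3 := dTM_nonneg X V
  rw [intFn, ← hr] at h2
  linarith

lemma exists_of_mem_horoCpt [Nonempty (Fin n)] {h : PDn n → ℝ}
    (hmem : h ∈ horoCpt (dTM n) (uPD n)) (hnot : h ∉ Set.range (intFn (dTM n) (uPD n))) :
    ∃ Y Z : Matrix (Fin n) (Fin n) ℂ, 0 ≤ Y ∧ 0 ≤ Z ∧ Y * Z = 0 ∧ ‖(Y, Z)‖ = 1 ∧
      h = fun X => Real.log (X.maxGauge (Y, Z)) := by
  obtain ⟨⟨c, Y, Z⟩, ⟨hc, hsphere, hY, hZ, hmul⟩, rfl⟩ := closure_minimal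
    (Set.range_subset_iff.2 intFn_mem_image_horoPairs) isClosed_image_horoPairs hmem
  have hnorm : ‖(Y, Z)‖ = 1 := by simpa using hsphere
  rcases hc.1.eq_or_lt with h0 | h0
  · refine ⟨Y, Z, hY, hZ, ?_, hnorm, rfl⟩
    dsimp only at hmul h0
    rw [hmul, ← h0, zero_smul]
  · exact absurd (log_maxGauge_mem_range h0 ⟨hY, hZ⟩ hnorm hmul) hnot

open scoped Classical in
lemma log_maxGauge_eq_ite {Y Z : Matrix (Fin n) (Fin n) ℂ} (hY : 0 ≤ Y) (hZ : 0 ≤ Z)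
    (X : PDn n) :
    Real.log (X.maxGauge (Y, Z)) =
      if Y = 0 then Real.log (sInf {β : ℝ | 0 < β ∧ loe Z (β • (X.1)⁻¹)})
      else if Z = 0 then Real.log (sInf {β : ℝ | 0 < β ∧ loe Y (β • X.1)})
      else max (Real.log (sInf {β : ℝ | 0 < β ∧ loe Y (β • X.1)}))
               (Real.log (sInf {β : ℝ | 0 < β ∧ loe Z (β • (X.1)⁻¹)})) := by
  have hZX : sInf {β : ℝ | 0 < β ∧ loe Z (β • (X.1)⁻¹)} = X.inv.gauge Z := X.inv.sInf_eq_gauge hZ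
  have hY0 := X.gauge_nonneg Y
  have hZ0 := X.inv.gauge_nonneg Z
  rw [hZX, X.sInf_eq_gauge hY, PDn.maxGauge]
  split_ifs with h1 h2
  · rw [X.gauge_eq_zero_iff.2 h1, max_eq_right hZ0]
  · rw [X.inv.gauge_eq_zero_iff.2 h2, max_eq_left hY0]
  · have hY1 := hY0.lt_of_ne' fun h => h1 (X.gauge_eq_zero_iff.1 h)
    have hZ1 := hZ0.lt_of_ne' fun h => h2 (X.inv.gauge_eq_zero_iff.1 h)
    exact Real.strictMonoOn_log.monotoneOn.map_max hY1 hZ1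

lemma max_hermNorm_eq [Nonempty (Fin n)] {Y Z : Matrix (Fin n) (Fin n) ℂ} (hY : Y.PosSemidef)
    (hZ : Z.PosSemidef) : max (hermNorm hY.1) (hermNorm hZ.1) = ‖(Y, Z)‖ := by
  rw [hermNorm_eq_norm, hermNorm_eq_norm, Prod.norm_def]

lemma anticommute_iff {Y Z : Matrix (Fin n) (Fin n) ℂ} (hY : 0 ≤ Y) (hZ : 0 ≤ Z) :
    Y * Z + Z * Y = 0 ↔ Y * Z = 0 :=
  ⟨mul_eq_zero_of_anticommute hY hZ, fun h => by
    rw [h, mul_eq_zero_symm_of_nonneg hY hZ h, add_zero]⟩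

/-- The horofunctions are the functions `log ∘ maxGauge` of pairs with product zero. -/
lemma horofunction_iff [Nonempty (Fin n)] (h : PDn n → ℝ) :
    (h ∈ horoCpt (dTM n) (uPD n) ∧ h ∉ Set.range (intFn (dTM n) (uPD n))) ↔
      ∃ (Y Z : Matrix (Fin n) (Fin n) ℂ) (hY : Y.PosSemidef) (hZ : Z.PosSemidef),
        Y * Z + Z * Y = 0 ∧ max (hermNorm hY.1) (hermNorm hZ.1) = 1 ∧
        ∀ X : PDn n, h X = Real.log (X.maxGauge (Y, Z)) := by
  constructor
  · rintro ⟨hmem, hnot⟩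
    obtain ⟨Y, Z, hY, hZ, hmul, hnorm, rfl⟩ := exists_of_mem_horoCpt hmem hnot
    have hY' := Matrix.nonneg_iff_posSemidef.1 hY
    have hZ' := Matrix.nonneg_iff_posSemidef.1 hZ
    exact ⟨Y, Z, hY', hZ', (anticommute_iff hY hZ).2 hmul,
      (max_hermNorm_eq hY' hZ').trans hnorm, fun _ => rfl⟩
  · rintro ⟨Y, Z, hY, hZ, hanti, hmax, hh⟩
    have hY0 := Matrix.nonneg_iff_posSemidef.2 hY
    have hZ0 := Matrix.nonneg_iff_posSemidef.2 hZ
    have hmul := (anticommute_iff hY0 hZ0).1 hanti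
    have hnorm := (max_hermNorm_eq hY hZ).symm.trans hmax
    obtain rfl : h = _ := funext hh
    exact ⟨log_maxGauge_mem_horoCpt hY0 hZ0 hmul hnorm,
      log_maxGauge_notMem_range hY0 hZ0 hmul hnorm⟩

end Thompson

open scoped Classical in
theorem stmt7 (n : ℕ) (hn : 1 ≤ n) (h : PDn n → ℝ) :
    (h ∈ horoCpt (dTM n) (uPD n) ∧ h ∉ Set.range (intFn (dTM n) (uPD n))) ↔
      ∃ (Y Z : Matrix (Fin n) (Fin n) ℂ) (hY : Y.PosSemidef) (hZ : Z.PosSemidef),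
        Y * Z + Z * Y = 0 ∧ max (hermNorm hY.1) (hermNorm hZ.1) = 1 ∧
        ∀ X : PDn n, h X =
          if Y = 0 then Real.log (sInf {β : ℝ | 0 < β ∧ loe Z (β • (X.1)⁻¹)})
          else if Z = 0 then Real.log (sInf {β : ℝ | 0 < β ∧ loe Y (β • X.1)})
          else max (Real.log (sInf {β : ℝ | 0 < β ∧ loe Y (β • X.1)}))
                   (Real.log (sInf {β : ℝ | 0 < β ∧ loe Z (β • (X.1)⁻¹)})) := by
  have : Nonempty (Fin n) := ⟨⟨0, hn⟩⟩
  rw [horofunction_iff]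
  refine exists₂_congr fun Y Z => exists₂_congr fun hY hZ => and_congr_right fun _ =>
    and_congr_right fun _ => forall_congr' fun X => ?_
  rw [log_maxGauge_eq_ite (Matrix.nonneg_iff_posSemidef.2 hY)
    (Matrix.nonneg_iff_posSemidef.2 hZ)]
end

section
/- Every horofunction g of the normed space (T, |·|) with basepoint 0 has the following form: there exist disjoint nonempty subsets I, J ⊆ {1,…,n} and real numbers α_k ≥ 0 for k ∈ I ∪ J with min_{i∈I} α_i = 0 and min_{j∈J} α_j = 0, such that for all v ∈ T: g(v) = max_{i∈I}(−v_i − α_i) + max_{j∈J}(v_j − α_j). -/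
open Filter Topology

/-- The space `T = {v ∈ ℝⁿ : v₁ + ⋯ + vₙ = 0}`. -/
def Tsp (n : ℕ) : Type := {v : Fin n → ℝ // ∑ i, v i = 0}

/-- The distance of the variation norm `|v| = max vᵢ - min vᵢ` on `T`. -/
noncomputable def dVar (n : ℕ) (v w : Tsp n) : ℝ :=
  (⨆ i, (v.1 i - w.1 i)) - ⨅ i, (v.1 i - w.1 i)

/-- The basepoint `0 ∈ T`. -/
def zeroT (n : ℕ) : Tsp n := ⟨0, by simp⟩

/-- Along an ultrafilter a nonnegative real function either converges or tends to infinity. -/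
theorem Ultrafilter.tendsto_nhds_or_tendsto_atTop {Y : Type*} (U : Ultrafilter Y) (f : Y → ℝ)
    (hf : ∀ y, 0 ≤ f y) : (∃ a, 0 ≤ a ∧ Tendsto f U (𝓝 a)) ∨ Tendsto f U atTop := by
  by_cases h : ∃ c, ∀ᶠ y in (U : Filter Y), f y ≤ c
  · obtain ⟨c, hc⟩ := h
    left
    have hmem : ((U.map f : Ultrafilter ℝ) : Filter ℝ) ≤ 𝓟 (Set.Icc 0 c) := by
      rw [le_principal_iff]
      exact hc.mono fun y hy => ⟨hf y, hy⟩
    obtain ⟨a, ha, hle⟩ := isCompact_Icc.ultrafilter_le_nhds _ hmem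
    exact ⟨a, ha.1, hle⟩
  · right
    push Not at h
    refine tendsto_atTop.2 fun c => ?_
    exact (h c).mono fun y hy => hy.le

/-- The ultrafilter limit of `max_j (z_j - p_j)` for nonnegative `p_j`, one of which always
vanishes, only involves the indices `j` for which `p_j` stays bounded. -/
theorem Ultrafilter.exists_tendsto_iSup_sub {Y ι : Type*} [Fintype ι] (U : Ultrafilter Y)
    (p : ι → Y → ℝ) (hp : ∀ j y, 0 ≤ p j y) (hz : ∀ y, ∃ j, p j y = 0) :
    ∃ (J : Finset ι) (hJ : J.Nonempty) (α : ι → ℝ), (∀ j ∈ J, 0 ≤ α j) ∧ J.inf' hJ α = 0 ∧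
      (∀ j ∈ J, Tendsto (p j) U (𝓝 (α j))) ∧
      ∀ z : ι → ℝ,
        Tendsto (fun y => ⨆ j, (z j - p j y)) U (𝓝 (J.sup' hJ fun j => z j - α j)) := by
  classical
  obtain ⟨k, hk⟩ : ∃ k, ∀ᶠ y in (U : Filter Y), p k y = 0 := by
    by_contra! h
    obtain ⟨y, hy⟩ := (eventually_all.2 h).exists
    obtain ⟨j, hj⟩ := hz y
    exact hy j hj
  have hk0 : Tendsto (p k) U (𝓝 0) := tendsto_nhds_of_eventually_eq hk
  let J : Finset ι := Finset.univ.filter fun j => ∃ a, 0 ≤ a ∧ Tendsto (p j) U (𝓝 a)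
  have hkJ : k ∈ J := by simpa [J] using ⟨0, le_rfl, hk0⟩
  have hJex : ∀ j, ∃ a, j ∈ J → 0 ≤ a ∧ Tendsto (p j) U (𝓝 a) := fun j => by
    by_cases h : j ∈ J
    · obtain ⟨a, ha⟩ := (Finset.mem_filter.1 h).2
      exact ⟨a, fun _ => ha⟩
    · exact ⟨0, fun h' => absurd h' h⟩
  choose α hα using hJex
  have hout : ∀ j ∉ J, Tendsto (p j) U atTop := fun j hj =>
    (U.tendsto_nhds_or_tendsto_atTop (p j) (hp j)).resolve_left fun h =>
      hj (Finset.mem_filter.2 ⟨Finset.mem_univ j, h⟩)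
  have hαk : α k = 0 := tendsto_nhds_unique (hα k hkJ).2 hk0
  refine ⟨J, ⟨k, hkJ⟩, α, fun j hj => (hα j hj).1, ?_, fun j hj => (hα j hj).2, fun z => ?_⟩
  · refine le_antisymm (hαk ▸ Finset.inf'_le α hkJ) ?_
    exact Finset.le_inf' _ _ fun j hj => (hα j hj).1
  · have hlim : Tendsto (fun y => J.sup' ⟨k, hkJ⟩ fun j => z j - p j y) U
        (𝓝 (J.sup' ⟨k, hkJ⟩ fun j => z j - α j)) :=
      Tendsto.finset_sup'_nhds_apply _ fun j hj => tendsto_const_nhds.sub (hα j hj).2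
    refine hlim.congr' ?_
    have hlarge : ∀ᶠ y in (U : Filter Y), ∀ j, j ∉ J → z j - z k ≤ p j y :=
      eventually_all.2 fun j => by
        by_cases hj : j ∈ J
        · exact Eventually.of_forall fun y h => absurd hj h
        · exact ((hout j hj).eventually_ge_atTop _).mono fun y hy _ => hy
    filter_upwards [hlarge, hk] with y hy hky
    have : Nonempty ι := ⟨k⟩
    refine le_antisymm ?_ ?_
    · exact Finset.sup'_le _ _ fun j _ =>
        le_ciSup (f := fun j => z j - p j y) (Set.finite_range _).bddAbove j
    · refine ciSup_le fun j => ?_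
      by_cases hj : j ∈ J
      · exact Finset.le_sup' (fun j => z j - p j y) hj
      · refine le_trans ?_ (Finset.le_sup' (fun j => z j - p j y) hkJ)
        have := hy j hj
        linarith

/-- The internal functions of the variation norm as a sum of two maxima. -/
theorem intFn_dVar_eq {n : ℕ} [NeZero n] (y z : Tsp n) :
    intFn (dVar n) (zeroT n) y z =
      (⨆ i, (-z.1 i - ((⨆ k, y.1 k) - y.1 i))) + ⨆ j, (z.1 j - (y.1 j - ⨅ k, y.1 k)) := by
  have hb : ∀ f : Fin n → ℝ, BddAbove (Set.range f) := fun f => (Set.finite_range f).bddAbove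
  have hshift : ∀ (f : Fin n → ℝ) (c : ℝ), ⨆ i, (f i + c) = (⨆ i, f i) + c := fun f c =>
    (ciSup_add (hb f) c).symm
  have hneg : ∀ f : Fin n → ℝ, ⨅ i, f i = -⨆ i, -f i := fun f => by
    rw [iInf, iSup, Real.sInf_def, Set.neg_range]
  have h₁ : ∀ i, -z.1 i - ((⨆ k, y.1 k) - y.1 i) = -(z.1 i - y.1 i) + -⨆ k, y.1 k :=
    fun i => by ring
  have h₂ : ∀ j, z.1 j - (y.1 j - ⨅ k, y.1 k) = (z.1 j - y.1 j) + ⨅ k, y.1 k :=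
    fun j => by ring
  simp only [h₁, h₂, hshift, intFn, dVar, zeroT, Pi.zero_apply, zero_sub]
  rw [hneg fun i => z.1 i - y.1 i, hneg fun i => -y.1 i, hneg fun i => y.1 i]
  simp only [neg_neg]
  ring

/-- Internal functions depend continuously, pointwise, on the point of `T` that defines them. -/
theorem tendsto_intFn_dVar {n : ℕ} [NeZero n] {Y : Type*} {l : Filter Y} {f : Y → Tsp n}
    {w : Tsp n} (h : ∀ i, Tendsto (fun y => (f y).1 i) l (𝓝 (w.1 i))) (z : Tsp n) :
    Tendsto (fun y => intFn (dVar n) (zeroT n) (f y) z) l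
      (𝓝 (intFn (dVar n) (zeroT n) w z)) := by
  have hd : ∀ v : Tsp n, Tendsto (fun y => dVar n v (f y)) l (𝓝 (dVar n v w)) := fun v => by
    simp only [dVar, ← Finset.sup'_univ_eq_ciSup, ← Finset.inf'_univ_eq_ciInf]
    exact (Tendsto.finset_sup'_nhds_apply _ fun i _ => tendsto_const_nhds.sub (h i)).sub
      (Tendsto.finset_inf'_nhds_apply _ fun i _ => tendsto_const_nhds.sub (h i))
  exact (hd z).sub (hd _)

/-- If the oscillation of points of `T` stays bounded along an ultrafilter, then they converge. -/
theorem exists_tendsto_of_osc_le {n : ℕ} [NeZero n] (U : Ultrafilter (Tsp n)) (c : ℝ)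
    (hc : ∀ᶠ y in (U : Filter (Tsp n)), (⨆ k, y.1 k) - ⨅ k, y.1 k ≤ c) :
    ∃ w : Tsp n, ∀ i, Tendsto (fun y : Tsp n => y.1 i) U (𝓝 (w.1 i)) := by
  have hle : ∀ (y : Tsp n) i, (⨅ k, y.1 k) ≤ y.1 i := fun y i =>
    ciInf_le (Set.finite_range _).bddBelow i
  have hge : ∀ (y : Tsp n) i, y.1 i ≤ ⨆ k, y.1 k := fun y i =>
    le_ciSup (Set.finite_range _).bddAbove i
  have hconv : ∀ i, ∃ a, Tendsto (fun y : Tsp n => y.1 i - ⨅ k, y.1 k) U (𝓝 a) := fun i => by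
    rcases U.tendsto_nhds_or_tendsto_atTop (fun y : Tsp n => y.1 i - ⨅ k, y.1 k)
      (fun y => sub_nonneg.2 (hle y i)) with ⟨a, -, ha⟩ | h
    · exact ⟨a, ha⟩
    · obtain ⟨y, hy, hy'⟩ := (hc.and (h.eventually_gt_atTop c)).exists
      linarith [hge y i]
  choose a ha using hconv
  have hn : (n : ℝ) ≠ 0 := NeZero.ne _
  have hsum : ∀ y : Tsp n, (∑ i, (y.1 i - ⨅ k, y.1 k)) / n = -⨅ k, y.1 k := fun y => by
    rw [Finset.sum_sub_distrib, y.2]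
    simp
    field_simp
  refine ⟨⟨fun i => a i - (∑ k, a k) / n, ?_⟩, fun i => ?_⟩
  · simp [Finset.sum_sub_distrib]
    field_simp
    simp
  · refine ((ha i).sub ((tendsto_finsetSum Finset.univ fun k _ => ha k).div_const _)).congr
      fun y => ?_
    rw [hsum]
    ring

theorem stmt9 (n : ℕ) (hn : 2 ≤ n) (g : Tsp n → ℝ)
    (hg : g ∈ horoCpt (dVar n) (zeroT n) ∧ g ∉ Set.range (intFn (dVar n) (zeroT n))) :
    ∃ (I J : Finset (Fin n)) (hI : I.Nonempty) (hJ : J.Nonempty), Disjoint I J ∧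
      ∃ α : Fin n → ℝ, (∀ k ∈ I ∪ J, 0 ≤ α k) ∧ I.inf' hI α = 0 ∧ J.inf' hJ α = 0 ∧
        ∀ v : Tsp n,
          g v = I.sup' hI (fun i => -v.1 i - α i) + J.sup' hJ (fun j => v.1 j - α j) := by
  classical
  have : NeZero n := ⟨by lia⟩
  obtain ⟨hcl, hint⟩ := hg
  have hne : (comap (intFn (dVar n) (zeroT n)) (𝓝 g)).NeBot :=
    comap_neBot_iff.2 fun t ht => by
      obtain ⟨_, hft, y, rfl⟩ := mem_closure_iff_nhds.1 hcl t ht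
      exact ⟨y, hft⟩
  let U := Ultrafilter.of (comap (intFn (dVar n) (zeroT n)) (𝓝 g))
  have hU : Tendsto (intFn (dVar n) (zeroT n)) U (𝓝 g) :=
    tendsto_comap.mono_left (Ultrafilter.of_le _)
  have hUv : ∀ v, Tendsto (fun y => intFn (dVar n) (zeroT n) y v) U (𝓝 (g v)) :=
    tendsto_pi_nhds.1 hU
  obtain ⟨I, hI, β, hβ0, hβinf, hβlim, hβsup⟩ :=
    U.exists_tendsto_iSup_sub (fun i (y : Tsp n) => (⨆ k, y.1 k) - y.1 i)
      (fun i y => sub_nonneg.2 (le_ciSup (Set.finite_range _).bddAbove i))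
      (fun y => (exists_eq_ciSup_of_finite (f := y.1)).imp fun i hi => by rw [hi, sub_self])
  obtain ⟨J, hJ, γ, hγ0, hγinf, hγlim, hγsup⟩ :=
    U.exists_tendsto_iSup_sub (fun j (y : Tsp n) => y.1 j - ⨅ k, y.1 k)
      (fun j y => sub_nonneg.2 (ciInf_le (Set.finite_range _).bddBelow j))
      (fun y => (exists_eq_ciInf_of_finite (f := y.1)).imp fun i hi => by rw [hi, sub_self])
  have hdisj : Disjoint I J := by
    refine Finset.disjoint_left.2 fun k hkI hkJ => hint ?_
    have hosc := (hβlim k hkI).add (hγlim k hkJ)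
    obtain ⟨w, hw⟩ := exists_tendsto_of_osc_le U (β k + γ k + 1)
      ((hosc.eventually_le_const (lt_add_one _)).mono fun y hy => by linarith)
    exact ⟨w, funext fun z => tendsto_nhds_unique (tendsto_intFn_dVar hw z) (hUv z)⟩
  have hαI : ∀ k ∈ I, (if k ∈ I then β k else γ k) = β k := fun k hk => if_pos hk
  have hαJ : ∀ k ∈ J, (if k ∈ I then β k else γ k) = γ k := fun k hk =>
    if_neg (Finset.disjoint_right.1 hdisj hk)
  refine ⟨I, J, hI, hJ, hdisj, fun k => if k ∈ I then β k else γ k, fun k hk => ?_,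
    (Finset.inf'_congr hI rfl hαI).trans hβinf, (Finset.inf'_congr hJ rfl hαJ).trans hγinf,
    fun v => ?_⟩
  · rcases Finset.mem_union.1 hk with h | h
    · exact (hβ0 k h).trans_eq (hαI k h).symm
    · exact (hγ0 k h).trans_eq (hαJ k h).symm
  · rw [Finset.sup'_congr hI rfl fun i hi => congrArg (-v.1 i - ·) (hαI i hi),
      Finset.sup'_congr hJ rfl fun j hj => congrArg (v.1 j - ·) (hαJ j hj)]
    refine tendsto_nhds_unique (hUv v) ?_
    simp only [intFn_dVar_eq]
    exact (hβsup fun i => -v.1 i).add (hγsup v.1)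
end

section
/- Let I, J ⊆ {1,…,n} be disjoint and nonempty, and let α_k ≥ 0 for k ∈ I ∪ J satisfy min_{i∈I} α_i = 0 and min_{j∈J} α_j = 0. Define ζ ∈ ℝⁿ by ζ_i = −α_i for i ∈ I, ζ_j = α_j for j ∈ J, and ζ_k = 0 otherwise; let ω ∈ ℝⁿ have ω_i = 1 for i ∈ I, ω_j = −1 for j ∈ J, and ω_k = 0 otherwise; and for t > 0 set ξ^t = tω + ζ − (1/n)(Σ_k (tω + ζ)_k)·(1,…,1) ∈ T. Then for every v ∈ T, lim_{t→∞} ( |v − ξ^t| − |ξ^t| ) = max_{i∈I}(−v_i − α_i) + max_{j∈J}(v_j − α_j); in particular the function g(v) = max_{i∈I}(−v_i − α_i) + max_{j∈J}(v_j − α_j) is a horofunction of (T, |·|). -/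
open Filter Topology

theorem dVar_eq_sub {n : ℕ} {v w : Tsp n} {a b : ℝ}
    (ha : IsGreatest (Set.range fun k => v.1 k - w.1 k) a)
    (hb : IsLeast (Set.range fun k => v.1 k - w.1 k) b) : dVar n v w = a - b := by
  unfold dVar
  rw [iSup, iInf, ha.csSup_eq, hb.csInf_eq]

theorem dVar_comm {n : ℕ} (v w : Tsp n) : dVar n v w = dVar n w v := by
  have h (v w : Tsp n) : ⨅ k, (v.1 k - w.1 k) = -⨆ k, (w.1 k - v.1 k) := by
    rw [iInf, Real.sInf_def, ← Set.image_neg_eq_neg, ← Set.range_comp, iSup]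
    simp only [Function.comp_def, neg_sub]
  unfold dVar
  rw [h v w, h w v]
  ring

theorem dVar_nonneg {n : ℕ} (v w : Tsp n) : 0 ≤ dVar n v w :=
  sub_nonneg.2 <| Real.sInf_le_sSup _ (Set.finite_range _).bddBelow (Set.finite_range _).bddAbove

/-- An explicit form of the distance from `v` to a point that lies far along the ray
`t ↦ t • ω + ζ`, up to a translation `c` along `(1, …, 1)`. -/
theorem eventually_dVar_eq {n : ℕ} {I J : Finset (Fin n)}
    (hI : I.Nonempty) (hJ : J.Nonempty) (α : Fin n → ℝ) {ξ : ℝ → Tsp n} {c : ℝ → ℝ}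
    (hξI : ∀ t, ∀ k ∈ I, (ξ t).1 k = t - α k - c t)
    (hξJ : ∀ t, ∀ k ∈ J, (ξ t).1 k = -t + α k - c t)
    (hξ : ∀ t, ∀ k, k ∉ I → k ∉ J → (ξ t).1 k = -c t) (v : Tsp n) :
    ∀ᶠ t in atTop, dVar n v (ξ t) =
      2 * t + (I.sup' hI (fun i => -v.1 i - α i) + J.sup' hJ (fun j => v.1 j - α j)) := by
  obtain ⟨i, hi, hA⟩ := I.exists_mem_eq_sup' hI (fun i => -v.1 i - α i)
  obtain ⟨j, hj, hB⟩ := J.exists_mem_eq_sup' hJ (fun j => v.1 j - α j)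
  have hleA : ∀ k ∈ I, -v.1 k - α k ≤ I.sup' hI (fun i => -v.1 i - α i) :=
    fun k hk => I.le_sup' (fun i => -v.1 i - α i) hk
  have hleB : ∀ k ∈ J, v.1 k - α k ≤ J.sup' hJ (fun j => v.1 j - α j) :=
    fun k hk => J.le_sup' (fun j => v.1 j - α j) hk
  generalize I.sup' hI (fun i => -v.1 i - α i) = A at *
  generalize J.sup' hJ (fun j => v.1 j - α j) = B at *
  have hlarge : ∀ᶠ t in atTop, ∀ k, |v.1 k| + |α k| + |A| + |B| ≤ t :=
    eventually_all.2 fun k => eventually_ge_atTop _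
  filter_upwards [hlarge] with t ht
  have hbounds : ∀ k, -t - A + c t ≤ v.1 k - (ξ t).1 k ∧ v.1 k - (ξ t).1 k ≤ t + B + c t := by
    intro k
    have hk := ht k
    have hv := abs_le.1 (le_refl |v.1 k|)
    have hα := abs_le.1 (le_refl |α k|)
    have hA' := abs_le.1 (le_refl |A|)
    have hB' := abs_le.1 (le_refl |B|)
    have hv0 := abs_nonneg (v.1 k)
    have hα0 := abs_nonneg (α k)
    have hA0 := abs_nonneg A
    have hB0 := abs_nonneg B
    by_cases hkI : k ∈ I
    · rw [hξI t k hkI]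
      have := hleA k hkI
      constructor <;> linarith
    by_cases hkJ : k ∈ J
    · rw [hξJ t k hkJ]
      have := hleB k hkJ
      constructor <;> linarith
    · rw [hξ t k hkI hkJ]
      constructor <;> linarith
  have hmax : IsGreatest (Set.range fun k => v.1 k - (ξ t).1 k) (t + B + c t) := by
    refine ⟨⟨j, ?_⟩, Set.forall_mem_range.2 fun k => (hbounds k).2⟩
    simp only [hξJ t j hj]
    linarith
  have hmin : IsLeast (Set.range fun k => v.1 k - (ξ t).1 k) (-t - A + c t) := by
    refine ⟨⟨i, ?_⟩, Set.forall_mem_range.2 fun k => (hbounds k).1⟩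
    simp only [hξI t i hi]
    linarith
  rw [dVar_eq_sub hmax hmin]
  ring

theorem sup'_neg_eq_zero {ι : Type*} {s : Finset ι} (hs : s.Nonempty) {α : ι → ℝ}
    (h : s.inf' hs α = 0) : s.sup' hs (fun i => -α i) = 0 := by
  obtain ⟨i, hi, hα⟩ := s.exists_mem_eq_inf' hs α
  refine le_antisymm (Finset.sup'_le _ _ fun k hk => ?_) ?_
  · have := s.inf'_le α hk
    linarith
  · have := s.le_sup' (fun i => -α i) hi
    linarith

theorem stmt10 (n : ℕ) (hn : 2 ≤ n) (I J : Finset (Fin n)) (hd : Disjoint I J)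
    (hI : I.Nonempty) (hJ : J.Nonempty) (α : Fin n → ℝ)
    (hα : ∀ k ∈ I ∪ J, 0 ≤ α k) (hαI : I.inf' hI α = 0) (hαJ : J.inf' hJ α = 0)
    (ζ ω : Fin n → ℝ)
    (hζ : ζ = fun k => if k ∈ I then -α k else if k ∈ J then α k else 0)
    (hω : ω = fun k => if k ∈ I then 1 else if k ∈ J then -1 else 0)
    (ξ : ℝ → Tsp n)
    (hξ : ∀ t, (ξ t).1 = fun k => (t * ω k + ζ k) - (∑ m, (t * ω m + ζ m)) / n) :
    (∀ v : Tsp n,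
      Tendsto (fun t => dVar n v (ξ t) - dVar n (ξ t) (zeroT n)) atTop
        (𝓝 (I.sup' hI (fun i => -v.1 i - α i) + J.sup' hJ (fun j => v.1 j - α j)))) ∧
    (fun v : Tsp n => I.sup' hI (fun i => -v.1 i - α i) + J.sup' hJ (fun j => v.1 j - α j))
      ∈ horoCpt (dVar n) (zeroT n) \ Set.range (intFn (dVar n) (zeroT n)) := by
  have hξI : ∀ t, ∀ k ∈ I, (ξ t).1 k = t - α k - (∑ m, (t * ω m + ζ m)) / n := by
    intro t k hk
    simp only [hξ t, congrFun hζ k, congrFun hω k, if_pos hk]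
    ring
  have hξJ : ∀ t, ∀ k ∈ J, (ξ t).1 k = -t + α k - (∑ m, (t * ω m + ζ m)) / n := by
    intro t k hk
    simp only [hξ t, congrFun hζ k, congrFun hω k, if_neg (Finset.disjoint_right.1 hd hk),
      if_pos hk]
    ring
  have hξ0 : ∀ t, ∀ k, k ∉ I → k ∉ J → (ξ t).1 k = -((∑ m, (t * ω m + ζ m)) / n) := by
    intro t k hkI hkJ
    simp only [hξ t, congrFun hζ k, congrFun hω k, if_neg hkI, if_neg hkJ]
    ring
  have hdist := eventually_dVar_eq hI hJ α hξI hξJ hξ0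
  have hzero : I.sup' hI (fun i => -(zeroT n).1 i - α i) +
      J.sup' hJ (fun j => (zeroT n).1 j - α j) = 0 := by
    simp [zeroT, sup'_neg_eq_zero hI hαI, sup'_neg_eq_zero hJ hαJ]
  have hlim : ∀ v : Tsp n,
      Tendsto (fun t => dVar n v (ξ t) - dVar n (ξ t) (zeroT n)) atTop
        (𝓝 (I.sup' hI (fun i => -v.1 i - α i) + J.sup' hJ (fun j => v.1 j - α j))) := by
    intro v
    refine tendsto_const_nhds.congr' ?_
    filter_upwards [hdist v, hdist (zeroT n)] with t hv h0
    rw [dVar_comm (ξ t), hv, h0, hzero]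
    ring
  refine ⟨hlim, ?_, ?_⟩
  · refine mem_closure_of_tendsto (f := fun t => intFn (dVar n) (zeroT n) (ξ t)) (b := atTop)
      (tendsto_pi_nhds.2 fun v => (hlim v).congr fun t => ?_)
      (Eventually.of_forall fun t => Set.mem_range_self _)
    rw [dVar_comm (ξ t)]
    rfl
  · rintro ⟨y, hy⟩
    set t := dVar n (zeroT n) y + 1 with ht
    have hval := congrFun hy (ξ t)
    have hsupI : I.sup' hI (fun i => -(ξ t).1 i - α i) = -t + (∑ m, (t * ω m + ζ m)) / n := by
      rw [Finset.sup'_congr hI rfl fun k hk => ?_, Finset.sup'_const]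
      rw [hξI t k hk]
      ring
    have hsupJ : J.sup' hJ (fun j => (ξ t).1 j - α j) = -t - (∑ m, (t * ω m + ζ m)) / n := by
      rw [Finset.sup'_congr hJ rfl fun k hk => ?_, Finset.sup'_const]
      rw [hξJ t k hk]
      ring
    simp only [intFn, hsupI, hsupJ] at hval
    linarith [dVar_nonneg (ξ t) y, dVar_nonneg (zeroT n) y]
end
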